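/- arXiv:1009.0414 — 2 statements merged into one kernel-verified Lean document; each statement's English description precedes it below -/
import Mathlib

section
/- Let k be an integer with 1 ≤ k ≤ q−2 (so q ≥ 3). The space of P_I-invariants (S(V)⊗Λ(V)⊗Det^k)^{P_I} is a free module of rank 2^n over the invariant ring S(V)^{P_I}, with basis consisting of (θ_1θ_2⋯θ_ℓ)^{q−1−k} together with the elements M_{m_i;b_1,…,b_j}·θ_1^{q−2−k}⋯θ_i^{q−2−k}·θ_{i+1}^{q−1−k}⋯θ_ℓ^{q−1−k} for all 1 ≤ i ≤ ℓ, 1 ≤ j ≤ m_i and integer sequences 0 ≤ b_1 < b_2 < ⋯ < b_j ≤ m_i−1 with b_j ≥ m_{i−1}. -/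
open scoped TensorProduct
open MvPolynomial Finset

noncomputable section

/-- The symmetric algebra `S(V) = F[x_1,…,x_n]` of the natural module `V = F^n`. -/
abbrev SV (F : Type) [Field F] (n : ℕ) := MvPolynomial (Fin n) F

/-- The exterior algebra `Λ(V) = E[y_1,…,y_n]`. -/
abbrev LV (F : Type) [Field F] (n : ℕ) := ExteriorAlgebra F (Fin n → F)

/-- `S(V) ⊗ Λ(V)`. -/
abbrev SL (F : Type) [Field F] (n : ℕ) := SV F n ⊗[F] LV F n

/-- the variable `x_{a+1}` (0-indexed `a`), junk value `0` out of range. -/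
def xV (F : Type) [Field F] (n a : ℕ) : SV F n :=
  if h : a < n then X ⟨a, h⟩ else 0

/-- the exterior generator `y_{a+1}` (0-indexed `a`). -/
def yV (F : Type) [Field F] (n a : ℕ) : LV F n :=
  if h : a < n then ExteriorAlgebra.ι F (Pi.single (⟨a, h⟩ : Fin n) (1 : F)) else 0

/-- the product `y_{s_1} ⋯ y_{s_j}` over `S = {s_1 < ⋯ < s_j}` in increasing order. -/
def yProd (F : Type) [Field F] (n : ℕ) (S : Finset ℕ) : LV F n :=
  ((S.sort (· ≤ ·)).map (yV F n)).prod

/-- determinant of the matrix `(x_t^{q^c})` with rows indexed by `c ∈ R` in increasing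
order and columns by `t ∈ C` in increasing order; junk value `0` if sizes differ. -/
def subDet (F : Type) [Field F] (q n : ℕ) (R C : Finset ℕ) : SV F n :=
  if h : C.card = R.card then
    Matrix.det (Matrix.of fun i j : Fin R.card =>
      xV F n (C.orderEmbOfFin h j) ^ q ^ (R.orderEmbOfFin rfl i : ℕ))
  else 0

/-- Mui's element `M_{m;b_1,…,b_j}` where `B = {b_1 < ⋯ < b_j}` (0-indexed `b`'s);
for `B = ∅` this is the Moore determinant `det (x_t^{q^c})`. -/
def MuiM (F : Type) [Field F] (q n m : ℕ) (B : Finset ℕ) : SL F n :=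
  ∑ S ∈ (range m).powersetCard B.card,
    ((-1 : F) ^ (B.card * (B.card + 1) / 2 + (∑ s ∈ S, s) + B.card)) •
      (subDet F q n (range m \ B) (range m \ S) ⊗ₜ[F] yProd F n S)

/-- `∏_{c : F^a} (c_1 x_1 + ⋯ + c_a x_a + x_{t+1})` (0-indexed `t`). -/
def linProd (F : Type) [Field F] [Fintype F] (n a t : ℕ) : SV F n :=
  ∏ c : Fin a → F, ((∑ k : Fin a, MvPolynomial.C (c k) * xV F n k) + xV F n t)

/-- Dickson's `L_m = V_1 V_2 ⋯ V_m`. -/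
def Lm (F : Type) [Field F] [Fintype F] (n m : ℕ) : SV F n :=
  ∏ a ∈ range m, linProd F n a a

/-- The property characterizing the Dickson invariants `Q_{m,k}`:
`Q_{m,k} · L_m = L_{m,k}` in `F[x_1,…,x_m]`. -/
def DicksonProp (F : Type) [Field F] [Fintype F] (q : ℕ)
    (Q : (m : ℕ) → ℕ → SV F m) : Prop :=
  ∀ m k : ℕ, k ≤ m →
    Q m k * Lm F m m = subDet F q m (range (m + 1) \ {k}) (range m)

/-- action of a matrix on `S(V)` by linear substitution: `x_j ↦ ∑_i g_{ij} x_i`. -/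
def gAct (F : Type) [Field F] (n : ℕ) (g : Matrix (Fin n) (Fin n) F) :
    SV F n →ₐ[F] SV F n :=
  MvPolynomial.aeval fun j => ∑ i, MvPolynomial.C (g i j) * MvPolynomial.X i

/-- action of a matrix on `Λ(V)` by linear substitution: `y_j ↦ ∑_i g_{ij} y_i`. -/
def eAct (F : Type) [Field F] (n : ℕ) (g : Matrix (Fin n) (Fin n) F) :
    LV F n →ₐ[F] LV F n :=
  ExteriorAlgebra.map g.mulVecLin

/-- diagonal action of a matrix on `S(V) ⊗ Λ(V)`. -/
def tAct (F : Type) [Field F] (n : ℕ) (g : Matrix (Fin n) (Fin n) F) :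
    SL F n →ₐ[F] SL F n :=
  Algebra.TensorProduct.map (gAct F n g) (eAct F n g)

/-- the invariants of a set of matrices on `S(V) ⊗ Λ(V)`, as an `F`-subspace. -/
def invSL (F : Type) [Field F] (n : ℕ) (P : Set (Matrix (Fin n) (Fin n) F)) :
    Submodule F (SL F n) where
  carrier := {f | ∀ g ∈ P, tAct F n g f = f}
  add_mem' := fun ha hb g hg => by rw [map_add, ha g hg, hb g hg]
  zero_mem' := fun g hg => map_zero _
  smul_mem' := fun c f hf g hg => by rw [map_smul, hf g hg]

/-- the invariants of `S(V) ⊗ Λ(V) ⊗ Det^k`, i.e. elements with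
`det(g)^k (g·f) = f` for all `g ∈ P`. -/
def invSLtw (F : Type) [Field F] (n k : ℕ) (P : Set (Matrix (Fin n) (Fin n) F)) :
    Submodule F (SL F n) where
  carrier := {f | ∀ g ∈ P, g.det ^ k • tAct F n g f = f}
  add_mem' := fun ha hb g hg => by rw [map_add, smul_add, ha g hg, hb g hg]
  zero_mem' := fun g hg => by rw [map_zero, smul_zero]
  smul_mem' := fun c f hf g hg => by rw [map_smul, smul_comm, hf g hg]

/-- the invariants of a set of matrices on `S(V)`, as an `F`-subalgebra. -/
def invS (F : Type) [Field F] (n : ℕ) (P : Set (Matrix (Fin n) (Fin n) F)) :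
    Subalgebra F (SV F n) where
  carrier := {f | ∀ g ∈ P, gAct F n g f = f}
  mul_mem' := fun ha hb g hg => by rw [map_mul, ha g hg, hb g hg]
  one_mem' := fun g hg => map_one _
  add_mem' := fun ha hb g hg => by rw [map_add, ha g hg, hb g hg]
  zero_mem' := fun g hg => map_zero _
  algebraMap_mem' := fun c g hg => (gAct F n g).commutes c

/-- `v_{i,j+1}` (0-indexed `j`) for the composition `I`. -/
def vij (F : Type) [Field F] [Fintype F] (n : ℕ) (I : Composition n)
    (i : Fin I.length) (j : ℕ) : SV F n :=
  linProd F n (I.sizeUpTo i) (I.sizeUpTo i + j)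

/-- `θ_i = L_{n_i}(v_{i,1},…,v_{i,n_i})`. -/
def theta (F : Type) [Field F] [Fintype F] (n : ℕ) (I : Composition n)
    (i : Fin I.length) : SV F n :=
  MvPolynomial.aeval (fun t : Fin (I.blocksFun i) => vij F n I i t)
    (Lm F (I.blocksFun i) (I.blocksFun i))

/-- `q_{i,k} = Q_{n_i,k}(v_{i,1},…,v_{i,n_i})`, given the Dickson polynomials `Q`. -/
def qInv (F : Type) [Field F] [Fintype F] (n : ℕ) (Q : (m : ℕ) → ℕ → SV F m)
    (I : Composition n) (i : Fin I.length) (k : ℕ) : SV F n :=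
  MvPolynomial.aeval (fun t : Fin (I.blocksFun i) => vij F n I i t)
    (Q (I.blocksFun i) k)

/-- the index of the block (0-indexed) of the composition `I` containing `a`. -/
def blkIdx (n : ℕ) (I : Composition n) (a : ℕ) : ℕ :=
  ((range I.length).filter fun i => I.sizeUpTo (i + 1) ≤ a).card

/-- the parabolic subgroup `P_I`: invertible block upper-triangular matrices. -/
def PIset (F : Type) [Field F] (n : ℕ) (I : Composition n) :
    Set (Matrix (Fin n) (Fin n) F) :=
  {g | IsUnit g.det ∧ ∀ a b : Fin n, blkIdx n I b < blkIdx n I a → g a b = 0}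

/-- the subgroup `K_I ≤ P_I`: block upper-triangular with all diagonal blocks
of determinant `1`. -/
def KIset (F : Type) [Field F] (n : ℕ) (I : Composition n) :
    Set (Matrix (Fin n) (Fin n) F) :=
  {g | IsUnit g.det ∧ (∀ a b : Fin n, blkIdx n I b < blkIdx n I a → g a b = 0) ∧
    ∀ i : Fin I.length,
      Matrix.det (Matrix.of fun a b : Fin (I.blocksFun i) =>
        g (I.embedding i a) (I.embedding i b)) = 1}

/-- the unipotent subgroup `U_n` of uni-uppertriangular matrices. -/
def Uset (F : Type) [Field F] (n : ℕ) : Set (Matrix (Fin n) (Fin n) F) :=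
  {g | (∀ a b : Fin n, b < a → g a b = 0) ∧ ∀ a : Fin n, g a a = 1}

/-- `SL_n(q)`. -/
def SLset (F : Type) [Field F] (n : ℕ) : Set (Matrix (Fin n) (Fin n) F) :=
  {g | g.det = 1}

/-- `GL_n(q)`. -/
def GLset (F : Type) [Field F] (n : ℕ) : Set (Matrix (Fin n) (Fin n) F) :=
  {g | IsUnit g.det}

/-- the bigraded piece `S^i(V) ⊗ Λ^j(V)` of `S(V) ⊗ Λ(V)`. -/
def piece (F : Type) [Field F] (n i j : ℕ) : Submodule F (SL F n) :=
  LinearMap.range (TensorProduct.map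
    (MvPolynomial.homogeneousSubmodule (Fin n) F i).subtype
    (LinearMap.range (ExteriorAlgebra.ι F (M := Fin n → F)) ^ j).subtype)

/-- the Hilbert series in `ℤ[s][[t]]` of a bigraded subspace `W` of `S(V) ⊗ Λ(V)`:
the coefficient of `t^i` is `∑_{j=0}^n dim (W ∩ (S^i ⊗ Λ^j)) s^j`. -/
def Hser (F : Type) [Field F] (n : ℕ) (W : Submodule F (SL F n)) :
    PowerSeries (Polynomial ℤ) :=
  PowerSeries.mk fun i => ∑ j ∈ range (n + 1),
    Polynomial.C (Module.finrank F ↥(W ⊓ piece F n i j) : ℤ) * Polynomial.X ^ j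

/-- the Hilbert series in `ℤ[[t]]` of a graded subalgebra of `S(V)`. -/
def HserS (F : Type) [Field F] (n : ℕ) (W : Subalgebra F (SV F n)) :
    PowerSeries ℤ :=
  PowerSeries.mk fun d =>
    (Module.finrank F ↥(Subalgebra.toSubmodule W ⊓ MvPolynomial.homogeneousSubmodule (Fin n) F d) : ℤ)

/-- the index set for Mui-type basis elements attached to the composition `I`:
pairs `(i, B)` with `B = {b_1 < ⋯ < b_j} ⊆ {0,…,m_{i+1}−1}` nonempty and
`max B ≥ m_i` (0-indexed `i`). -/
def Adm (n : ℕ) (I : Composition n) : Finset (Fin I.length × Finset ℕ) :=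
  (Finset.univ ×ˢ (range n).powerset).filter fun x =>
    x.2 ⊆ range (I.sizeUpTo ((x.1 : ℕ) + 1)) ∧ x.2.Nonempty ∧ ∃ b ∈ x.2, I.sizeUpTo (x.1 : ℕ) ≤ b

/-- The product of the `y s` over `s ∈ S` in increasing order. -/
def sortedProd {E : Type*} [Monoid E] (y : ℕ → E) (S : Finset ℕ) : E :=
  ((S.sort (· ≤ ·)).map y).prod

/-- A family of pairwise anticommuting elements of square zero. -/
def Anticomm {E : Type*} [Ring E] (y : ℕ → E) : Prop :=
  (∀ a, y a * y a = 0) ∧ ∀ a b, y a * y b = -(y b * y a)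

/-- The minor of `A` with rows in `R` and columns in `C`, in increasing order, and `0` if the
sizes differ. -/
def minorDet {K : Type*} [CommRing K] (A : ℕ → ℕ → K) (R C : Finset ℕ) : K :=
  if h : C.card = R.card then
    Matrix.det (Matrix.of fun i j : Fin R.card =>
      A (R.orderEmbOfFin rfl i) (C.orderEmbOfFin h j))
  else 0

section Anticommuting

theorem sortedProd_map {E G H : Type*} [Monoid E] [Monoid G] [FunLike H E G] [MonoidHomClass H E G]
    (f : H) (y : ℕ → E) (S : Finset ℕ) :
    f (sortedProd y S) = sortedProd (fun a => f (y a)) S := by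
  simp [sortedProd, map_list_prod f, Function.comp_def]

theorem sortedProd_congr {E : Type*} [Monoid E] {y z : ℕ → E} {S : Finset ℕ}
    (h : ∀ s ∈ S, y s = z s) : sortedProd y S = sortedProd z S := by
  unfold sortedProd
  congr 1
  refine List.map_congr_left fun a ha => h a ?_
  simpa using ha

theorem sortedProd_empty {E : Type*} [Monoid E] (y : ℕ → E) : sortedProd y ∅ = 1 := by
  simp [sortedProd]

theorem sortedProd_eq_ofFn {E : Type*} [Monoid E] (y : ℕ → E) (S : Finset ℕ) {r : ℕ}
    (h : S.card = r) :
    sortedProd y S = (List.ofFn fun i : Fin r => y (S.orderEmbOfFin h i)).prod := by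
  subst h
  unfold sortedProd
  congr 1
  apply List.ext_getElem
  · simp
  · intro i h1 h2
    simp [Finset.orderEmbOfFin_apply]

theorem sortedProd_insert_max {E : Type*} [Monoid E] (y : ℕ → E) {S : Finset ℕ} {m : ℕ}
    (h : S ⊆ range m) : sortedProd y (insert m S) = sortedProd y S * y m := by
  have hm : m ∉ S := fun hm => by simpa using h hm
  have key : (insert m S).sort (· ≤ ·) = S.sort (· ≤ ·) ++ [m] := by
    refine List.Perm.eq_of_pairwise' (r := (· ≤ ·)) ?_ ?_ ?_
    · exact Finset.pairwise_sort _ _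
    · rw [List.pairwise_append]
      refine ⟨Finset.pairwise_sort _ _, by simp, ?_⟩
      intro a ha b hb
      simp only [List.mem_singleton] at hb
      subst hb
      have : a ∈ S := by simpa using ha
      exact (Finset.mem_range.1 (h this)).le
    · rw [List.perm_ext_iff_of_nodup (Finset.sort_nodup _ _)]
      · intro a
        simp [or_comm]
      · rw [List.nodup_append]
        refine ⟨Finset.sort_nodup _ _, by simp, ?_⟩
        intro a ha b hb
        simp only [List.mem_singleton] at hb
        subst hb
        have : a ∈ S := by simpa using ha
        exact fun hab => hm (hab ▸ this)
  simp [sortedProd, key]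

variable {E : Type*} [Ring E] {y : ℕ → E}

theorem Anticomm.perm (hy : Anticomm y) {l l' : List ℕ} (h : l.Perm l') :
    (l.map y).prod = (l'.map y).prod ∨ (l.map y).prod = -(l'.map y).prod := by
  induction h with
  | nil => simp
  | cons a _ ih =>
    rcases ih with h | h <;> simp [h]
  | swap a b l =>
    right
    simp only [List.map_cons, List.prod_cons, ← mul_assoc]
    rw [hy.2 b a, neg_mul]
  | trans _ _ h1 h2 =>
    rcases h1 with h1 | h1 <;> rcases h2 with h2 | h2 <;> simp [h1, h2]

theorem Anticomm.prod_eq_zero (hy : Anticomm y) {l : List ℕ} (h : ¬ l.Nodup) :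
    (l.map y).prod = 0 := by
  obtain ⟨a, ha⟩ := List.exists_duplicate_iff_not_nodup.2 h
  obtain ⟨l', hl'⟩ := (List.duplicate_iff_sublist.1 ha).exists_perm_append
  have h0 : (([a, a] ++ l').map y).prod = 0 := by
    simp [← mul_assoc, hy.1 a]
  rcases hy.perm hl' with h | h <;> rw [h, h0]
  simp

theorem Anticomm.prod_eq_sortedProd (hy : Anticomm y) {l : List ℕ} (h : l.Nodup) :
    (l.map y).prod = sortedProd y l.toFinset ∨ (l.map y).prod = -sortedProd y l.toFinset :=
  hy.perm ((List.toFinset_toList h).symm.trans (Finset.sort_perm_toList _ _).symm)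

theorem Anticomm.sortedProd_mul_eq_zero (hy : Anticomm y) {S T : Finset ℕ}
    (h : ¬ Disjoint S T) : sortedProd y S * sortedProd y T = 0 := by
  unfold sortedProd
  rw [← List.prod_append, ← List.map_append]
  apply hy.prod_eq_zero
  intro hn
  apply h
  rw [Finset.disjoint_left]
  intro a ha hb
  exact (List.nodup_append.1 hn).2.2 a (by simpa using ha) a (by simpa using hb) rfl

theorem Anticomm.sortedProd_mul_single (hy : Anticomm y) {S : Finset ℕ} {b : ℕ} (h : b ∈ S) :
    sortedProd y S * y b = 0 := by
  have := hy.sortedProd_mul_eq_zero (S := S) (T := {b}) (by simpa using h)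
  simpa [sortedProd] using this

theorem Anticomm.mul_list_prod (hy : Anticomm y) (m : ℕ) (l : List ℕ) :
    y m * (l.map y).prod = (-1) ^ l.length * ((l.map y).prod * y m) := by
  induction l with
  | nil => simp
  | cons a l ih =>
    simp only [List.map_cons, List.prod_cons, List.length_cons]
    rw [← mul_assoc, hy.2 m a, neg_mul, mul_assoc, ih, pow_succ]
    have hc : Commute (y a) ((-1 : E) ^ l.length) :=
      (Commute.neg_one_right (y a)).pow_right _
    rw [← mul_assoc (y a), hc.eq]
    noncomm_ring

theorem Anticomm.mul_sortedProd (hy : Anticomm y) (m : ℕ) (S : Finset ℕ) :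
    y m * sortedProd y S = (-1) ^ S.card * (sortedProd y S * y m) := by
  simpa [sortedProd] using hy.mul_list_prod m (S.sort (· ≤ ·))

theorem Anticomm.sortedProd_mul_compl (hy : Anticomm y) (m : ℕ) :
    ∀ S ⊆ range m, sortedProd y S * sortedProd y (range m \ S) =
      (-1) ^ (S.card * (S.card + 1) / 2 + (∑ s ∈ S, s) + S.card) * sortedProd y (range m) := by
  induction m with
  | zero =>
    intro S hS
    obtain rfl : S = ∅ := by simpa using hS
    simp [sortedProd]
  | succ m ih =>
    intro S hS
    rw [show range (m + 1) = insert m (range m) from Finset.range_add_one,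
      sortedProd_insert_max y subset_rfl]
    by_cases hm : m ∈ S
    · obtain ⟨S', hmS', rfl⟩ : ∃ S', m ∉ S' ∧ insert m S' = S :=
        ⟨S.erase m, Finset.notMem_erase _ _, Finset.insert_erase hm⟩
      have hsub : S' ⊆ range m := by
        intro a ha
        have h1 := hS (Finset.mem_insert_of_mem ha)
        have h2 : a ≠ m := fun h => hmS' (h ▸ ha)
        simp only [Finset.mem_range] at *
        omega
      have e1 : insert m (range m) \ insert m S' = range m \ S' := by
        rw [Finset.insert_sdiff_insert, Finset.sdiff_insert_of_notMem (by simp)]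
      have hcard : (range m \ S').card + S'.card = m := by
        rw [Finset.card_sdiff_add_card_eq_card hsub, Finset.card_range]
      rw [e1, sortedProd_insert_max y hsub, mul_assoc, hy.mul_sortedProd,
        Finset.card_insert_of_notMem hmS', Finset.sum_insert hmS']
      have hc : Commute (sortedProd y S') ((-1 : E) ^ (range m \ S').card) :=
        (Commute.neg_one_right _).pow_right _
      rw [← mul_assoc, hc.eq, mul_assoc, ← mul_assoc (sortedProd y S'), ih S' hsub]
      simp only [← mul_assoc]
      rw [← pow_add]
      congr 2
      have h2 : (S'.card + 1) * (S'.card + 1 + 1) / 2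
          = S'.card * (S'.card + 1) / 2 + (S'.card + 1) := by
        rw [show (S'.card + 1) * (S'.card + 1 + 1)
          = S'.card * (S'.card + 1) + (S'.card + 1) * 2 by ring]
        omega
      rw [h2]
      rw [show S'.card * (S'.card + 1) / 2 + (S'.card + 1) + (m + ∑ s ∈ S', s) + (S'.card + 1)
        = (range m \ S').card + (S'.card * (S'.card + 1) / 2 + (∑ s ∈ S', s) + S'.card)
          + 2 * (S'.card + 1) by
          generalize S'.card * (S'.card + 1) / 2 = u
          omega, pow_add _ _ (2 * _), pow_mul]
      simp
    · have hsub : S ⊆ range m := by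
        intro a ha
        have h1 := hS ha
        have h2 : a ≠ m := fun h => hm (h ▸ ha)
        simp only [Finset.mem_range] at *
        omega
      have e1 : insert m (range m) \ S = insert m (range m \ S) :=
        Finset.insert_sdiff_of_notMem _ hm
      rw [e1, sortedProd_insert_max y Finset.sdiff_subset, ← mul_assoc, ih S hsub, mul_assoc]

end Anticommuting

section Laplace

variable {K E : Type*} [CommRing K] [Ring E] [Algebra K E] {y : ℕ → E}

theorem Anticomm.mul_eq_neg_of_mem_span (hy : Anticomm y) {u v : E}
    (hu : u ∈ Submodule.span K (Set.range y)) (hv : v ∈ Submodule.span K (Set.range y)) :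
    u * v = -(v * u) := by
  induction hu, hv using Submodule.span_induction₂ with
  | mem_mem a b ha hb =>
    obtain ⟨a, rfl⟩ := ha
    obtain ⟨b, rfl⟩ := hb
    exact hy.2 a b
  | zero_left b _ => simp
  | zero_right a _ => simp
  | add_left a b c _ _ _ h1 h2 => rw [add_mul, mul_add, h1, h2, neg_add]
  | add_right a b c _ _ _ h1 h2 => rw [add_mul, mul_add, h1, h2, neg_add]
  | smul_left r a b _ _ h => rw [smul_mul_assoc, mul_smul_comm, h, smul_neg]
  | smul_right r a b _ _ h => rw [smul_mul_assoc, mul_smul_comm, h, smul_neg]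

theorem Anticomm.mul_self_of_mem_span (hy : Anticomm y) {u : E}
    (hu : u ∈ Submodule.span K (Set.range y)) : u * u = 0 := by
  induction hu using Submodule.span_induction with
  | mem a ha => obtain ⟨a, rfl⟩ := ha; exact hy.1 a
  | zero => simp
  | add a b ha hb h1 h2 =>
    rw [add_mul, mul_add, mul_add, h1, h2, hy.mul_eq_neg_of_mem_span ha hb]
    abel
  | smul r a _ h => rw [smul_mul_assoc, mul_smul_comm, h, smul_zero, smul_zero]

theorem Anticomm.of_mem_span (hy : Anticomm y) {z : ℕ → E}
    (hz : ∀ a, z a ∈ Submodule.span K (Set.range y)) : Anticomm z :=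
  ⟨fun a => hy.mul_self_of_mem_span (hz a), fun a b => hy.mul_eq_neg_of_mem_span (hz a) (hz b)⟩

/-- The linear combinations of a family given by the columns of a matrix. -/
def comb (A : ℕ → ℕ → K) (R : Finset ℕ) (y : ℕ → E) (s : ℕ) : E := ∑ c ∈ R, A c s • y c

theorem comb_mem_span (A : ℕ → ℕ → K) (R : Finset ℕ) (y : ℕ → E) (s : ℕ) :
    comb A R y s ∈ Submodule.span K (Set.range y) :=
  Submodule.sum_mem _ fun c _ => Submodule.smul_mem _ _ (Submodule.subset_span ⟨c, rfl⟩)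

theorem Anticomm.comb (hy : Anticomm y) (A : ℕ → ℕ → K) (R : Finset ℕ) :
    Anticomm (comb A R y) :=
  hy.of_mem_span (comb_mem_span A R y)

theorem ofFn_prod_eq_det_smul {r : ℕ} (z : Fin r → E)
    (hz : ∀ v : Fin r → K, (∑ c, v c • z c) * (∑ c, v c • z c) = 0)
    (A : Matrix (Fin r) (Fin r) K) :
    (List.ofFn fun i => ∑ c, A c i • z c).prod = A.det • (List.ofFn z).prod := by
  let f : (Fin r → K) →ₗ[K] E := Fintype.linearCombination K z
  have hf : ∀ v, f v = ∑ c, v c • z c := fun v => rfl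
  let g := ExteriorAlgebra.lift K (⟨f, fun v => by rw [hf]; exact hz v⟩ :
    {f : (Fin r → K) →ₗ[K] E // ∀ m, f m * f m = 0})
  let a1 : (Fin r → K) [⋀^Fin r]→ₗ[K] E :=
    g.toLinearMap.compAlternatingMap (ExteriorAlgebra.ιMulti K r)
  let a2 : (Fin r → K) [⋀^Fin r]→ₗ[K] E :=
    (LinearMap.toSpanSingleton K E (List.ofFn z).prod).compAlternatingMap
      (Matrix.detRowAlternating (R := K) (n := Fin r))
  have h1 : ∀ v, a1 v = (List.ofFn fun i => f (v i)).prod := by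
    intro v
    simp only [a1, g, LinearMap.compAlternatingMap_apply, ExteriorAlgebra.ιMulti_apply,
      AlgHom.toLinearMap_apply, map_list_prod, List.map_ofFn, Function.comp_def]
    simp only [ExteriorAlgebra.lift_ι_apply]
  have h1e : a1 (fun i => Pi.basisFun K (Fin r) i) = (List.ofFn z).prod := by
    rw [h1]
    simp [hf, Pi.single_apply]
  have h2e : a2 (fun i => Pi.basisFun K (Fin r) i) = (List.ofFn z).prod := by
    have : (fun i => Pi.basisFun K (Fin r) i) = (1 : Matrix (Fin r) (Fin r) K) := by
      ext i j
      simp [Matrix.one_apply, Pi.single_apply, eq_comm]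
    simp only [a2, this, LinearMap.compAlternatingMap_apply]
    change LinearMap.toSpanSingleton K E _ (Matrix.det 1) = _
    simp
  have h2 : a1 = a2 := by
    refine (Pi.basisFun K (Fin r)).ext_alternating fun v hv => ?_
    let σ : Equiv.Perm (Fin r) := Equiv.ofBijective v (Finite.injective_iff_bijective.1 hv)
    have e1 := a1.map_perm (fun i => Pi.basisFun K (Fin r) i) σ
    have e2 := a2.map_perm (fun i => Pi.basisFun K (Fin r) i) σ
    rw [h1e] at e1
    rw [h2e] at e2
    exact e1.trans e2.symm
  have h3 : a1 (fun i c => A c i) = A.det • (List.ofFn z).prod := by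
    rw [h2, ← Matrix.det_transpose]
    rfl
  exact (h1 _).symm.trans h3

theorem minorDet_eq (A : ℕ → ℕ → K) {R C : Finset ℕ} {r : ℕ} (hR : R.card = r) (hC : C.card = r) :
    minorDet A R C = Matrix.det (Matrix.of fun i j : Fin r =>
      A (R.orderEmbOfFin hR i) (C.orderEmbOfFin hC j)) := by
  subst hR
  rw [minorDet, dif_pos hC]

theorem orderEmbOfFin_range (m : ℕ) (i : Fin m) :
    (range m).orderEmbOfFin (Finset.card_range m) i = i := by
  have := Finset.orderEmbOfFin_unique (s := range m) (Finset.card_range m)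
    (f := fun i : Fin m => (i : ℕ)) (by simp) (fun a b h => h)
  exact (congrFun this i).symm

theorem minorDet_range (A : ℕ → ℕ → K) (m : ℕ) :
    minorDet A (range m) (range m) = Matrix.det (Matrix.of fun i j : Fin m => A i j) := by
  rw [minorDet_eq A (Finset.card_range m) (Finset.card_range m)]
  simp only [orderEmbOfFin_range]

theorem comb_eq_sum_fin (A : ℕ → ℕ → K) (R : Finset ℕ) (y : ℕ → E) (s : ℕ) {r : ℕ}
    (h : R.card = r) :
    comb A R y s = ∑ c : Fin r, A (R.orderEmbOfFin h c) s • y (R.orderEmbOfFin h c) := by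
  unfold comb
  conv_lhs => rw [← Finset.image_orderEmbOfFin_univ R h]
  rw [Finset.sum_image]
  intro a _ b _ hab
  exact (R.orderEmbOfFin h).injective hab

theorem Anticomm.sortedProd_mul_comb (hy : Anticomm y) (A : ℕ → ℕ → K) {M B C : Finset ℕ}
    (hB : B ⊆ M) (hC : C.card = (M \ B).card) :
    sortedProd y B * sortedProd (_root_.comb A M y) C =
      minorDet A (M \ B) C • (sortedProd y B * sortedProd y (M \ B)) := by
  have hsplit : ∀ s, _root_.comb A M y s = _root_.comb A B y s + _root_.comb A (M \ B) y s := by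
    intro s
    unfold _root_.comb
    rw [add_comm, Finset.sum_sdiff hB]
  have hkill : ∀ (l : List ℕ) (e : E), (∀ b ∈ B, e * y b = 0) →
      e * (l.map (_root_.comb A M y)).prod = e * (l.map (_root_.comb A (M \ B) y)).prod := by
    intro l
    induction l with
    | nil => simp
    | cons a l ih =>
      intro e he
      have h0 : e * _root_.comb A B y a = 0 := by
        unfold _root_.comb
        rw [Finset.mul_sum]
        refine Finset.sum_eq_zero fun b hb => ?_
        rw [mul_smul_comm, he b hb, smul_zero]
      have h1 : e * _root_.comb A M y a = e * _root_.comb A (M \ B) y a := by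
        rw [hsplit, mul_add, h0, zero_add]
      simp only [List.map_cons, List.prod_cons, ← mul_assoc]
      rw [h1]
      apply ih
      intro b hb
      rw [mul_assoc, hy.mul_eq_neg_of_mem_span (K := K) (comb_mem_span A _ y a)
        (Submodule.subset_span ⟨b, rfl⟩), mul_neg, ← mul_assoc, he b hb, zero_mul, neg_zero]
  have h1 : sortedProd y B * sortedProd (_root_.comb A M y) C =
      sortedProd y B * sortedProd (_root_.comb A (M \ B) y) C :=
    hkill _ _ fun b hb => hy.sortedProd_mul_single hb
  rw [h1, sortedProd_eq_ofFn _ C hC, minorDet_eq A rfl hC]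
  simp only [comb_eq_sum_fin A (M \ B) y _ rfl]
  have := ofFn_prod_eq_det_smul (fun i => y ((M \ B).orderEmbOfFin rfl i)) (fun v =>
    hy.mul_self_of_mem_span (K := K) (Submodule.sum_mem _ fun c _ => Submodule.smul_mem _ _
      (Submodule.subset_span ⟨_, rfl⟩)))
    (Matrix.of fun i j => A ((M \ B).orderEmbOfFin rfl i) (C.orderEmbOfFin hC j))
  simp only [Matrix.of_apply] at this
  rw [this, mul_smul_comm, sortedProd_eq_ofFn y (M \ B) rfl]

/-- The sign of the shuffle sorting `S` followed by its complement. -/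
def shuffleSign (K : Type*) [CommRing K] (S : Finset ℕ) : K :=
  (-1) ^ (S.card * (S.card + 1) / 2 + (∑ s ∈ S, s) + S.card)

theorem shuffleSign_mul_self (S : Finset ℕ) : shuffleSign K S * shuffleSign K S = 1 := by
  rw [shuffleSign, ← mul_pow]
  simp

theorem Anticomm.sortedProd_mul_compl_smul (hy : Anticomm y) {m : ℕ} {S : Finset ℕ}
    (hS : S ⊆ range m) : sortedProd y S * sortedProd y (range m \ S) =
      shuffleSign K S • sortedProd y (range m) := by
  rw [hy.sortedProd_mul_compl m S hS, shuffleSign, Algebra.smul_def]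
  simp

/-- Products of `j` elements among the `y s`, `s < m`. -/
def listSpan (K : Type*) {E : Type*} [CommRing K] [Ring E] [Algebra K E] (y : ℕ → E) (m j : ℕ) :
    Submodule K E :=
  Submodule.span K {e | ∃ l : List ℕ, (∀ s ∈ l, s < m) ∧ l.length = j ∧ e = (l.map y).prod}

theorem pow_smul_list_prod_mem (Y : ℕ → E) {m : ℕ} {L : K}
    (h : ∀ c < m, L • y c ∈ Submodule.span K {e | ∃ s < m, e = Y s}) (l : List ℕ)
    (hl : ∀ c ∈ l, c < m) : L ^ l.length • (l.map y).prod ∈ listSpan K Y m l.length := by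
  induction l with
  | nil =>
    simp only [List.length_nil, pow_zero, List.map_nil, List.prod_nil, one_smul]
    exact Submodule.subset_span ⟨[], by simp, rfl, by simp⟩
  | cons a l ih =>
    have h1 := ih fun c hc => hl c (List.mem_cons_of_mem _ hc)
    have h2 := Submodule.mul_mem_mul (h a (hl a List.mem_cons_self)) h1
    rw [smul_mul_smul_comm, ← pow_succ'] at h2
    simp only [List.map_cons, List.prod_cons, List.length_cons]
    refine (Submodule.mul_le.2 ?_ : _ ≤ listSpan K Y m (l.length + 1)) h2
    intro u hu v hv
    induction hu, hv using Submodule.span_induction₂ with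
    | mem_mem a b ha hb =>
      obtain ⟨s, hs, rfl⟩ := ha
      obtain ⟨l', h1, h2, rfl⟩ := hb
      exact Submodule.subset_span ⟨s :: l', by simpa [hs] using h1, by simp [h2], by simp⟩
    | zero_left b _ => simp
    | zero_right a _ => simp
    | add_left a b c _ _ _ h1 h2 => rw [add_mul]; exact Submodule.add_mem _ h1 h2
    | add_right a b c _ _ _ h1 h2 => rw [mul_add]; exact Submodule.add_mem _ h1 h2
    | smul_left r a b _ _ h => rw [smul_mul_assoc]; exact Submodule.smul_mem _ _ h
    | smul_right r a b _ _ h => rw [mul_smul_comm]; exact Submodule.smul_mem _ _ h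

theorem det_smul_mem_span_comb (A : ℕ → ℕ → K) (y : ℕ → E) (m c : ℕ) (hc : c < m) :
    minorDet A (range m) (range m) • y c ∈
      Submodule.span K {e | ∃ s < m, e = comb A (range m) y s} := by
  set A' : Matrix (Fin m) (Fin m) K := Matrix.of fun i j : Fin m => A i j with hA'
  have key : minorDet A (range m) (range m) • y c =
      ∑ s : Fin m, A'.adjugate s ⟨c, hc⟩ • comb A (range m) y s := by
    have h1 : ∀ s : Fin m, comb A (range m) y s = ∑ i : Fin m, A' i s • y i := by
      intro s
      simp only [comb, Finset.sum_range, hA', Matrix.of_apply]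
    simp only [h1, Finset.smul_sum, smul_smul]
    rw [Finset.sum_comm]
    simp only [← Finset.sum_smul]
    have h2 : ∀ i : Fin m, ∑ s, A'.adjugate s ⟨c, hc⟩ * A' i s = (A' * A'.adjugate) i ⟨c, hc⟩ := by
      intro i
      rw [Matrix.mul_apply]
      exact Finset.sum_congr rfl fun s _ => mul_comm _ _
    simp only [h2, Matrix.mul_adjugate, Matrix.smul_apply, Matrix.one_apply, minorDet_range]
    rw [Finset.sum_eq_single ⟨c, hc⟩]
    · simp [hA']
    · intro b _ hb
      simp [hb]
    · simp
  rw [key]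
  exact Submodule.sum_mem _ fun s _ => Submodule.smul_mem _ _
    (Submodule.subset_span ⟨s, s.2, rfl⟩)

/-- Generalized Laplace expansion along complementary minors, in an algebra with an anticommuting
family. -/
theorem Anticomm.laplace (hy : Anticomm y) (m : ℕ) (A : ℕ → ℕ → K) (top : E →ₗ[K] K)
    (htop : top (sortedProd y (range m)) = 1)
    (hreg : ∀ e : E, minorDet A (range m) (range m) • e = 0 → e = 0) {B : Finset ℕ}
    (hB : B ⊆ range m) :
    ∑ S ∈ (range m).powersetCard B.card, shuffleSign K S •
      minorDet A (range m \ B) (range m \ S) • sortedProd (_root_.comb A (range m) y) S =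
    shuffleSign K B • minorDet A (range m) (range m) • sortedProd y B := by
  set Y := _root_.comb A (range m) y with hY
  set L := minorDet A (range m) (range m) with hL
  have hYA : Anticomm Y := hy.comb A (range m)
  have htopY : sortedProd Y (range m) = L • sortedProd y (range m) := by
    have := hy.sortedProd_mul_comb A (M := range m) (B := ∅) (C := range m) (by simp) (by simp)
    simpa [sortedProd_empty] using this
  let Ψ : E →ₗ[K] E := ∑ S ∈ (range m).powersetCard B.card,
    (shuffleSign K S • (LinearMap.toSpanSingleton K E (sortedProd Y S)) ∘ₗ top ∘ₗ
      LinearMap.mulRight K (sortedProd Y (range m \ S))) - L • LinearMap.id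
  have hΨ : ∀ ω, Ψ ω = ∑ S ∈ (range m).powersetCard B.card,
      shuffleSign K S • top (ω * sortedProd Y (range m \ S)) • sortedProd Y S - L • ω := by
    intro ω
    simp [Ψ, LinearMap.sum_apply]
  have hsorted : ∀ T ∈ (range m).powersetCard B.card, Ψ (sortedProd Y T) = 0 := by
    intro T hT
    have hT' := Finset.mem_powersetCard.1 hT
    rw [hΨ, Finset.sum_eq_single T, hYA.sortedProd_mul_compl_smul (K := K) hT'.1, htopY,
      map_smul, map_smul, htop, smul_smul, smul_eq_mul, ← mul_assoc, shuffleSign_mul_self]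
    · simp
    · intro S hS hST
      have hS' := Finset.mem_powersetCard.1 hS
      rw [hYA.sortedProd_mul_eq_zero, map_zero, zero_smul, smul_zero]
      intro hd
      apply hST
      symm
      refine Finset.eq_of_subset_of_card_le ?_ (by rw [hS'.2, hT'.2])
      intro a ha
      by_contra haS
      exact Finset.disjoint_left.1 hd ha (Finset.mem_sdiff.2 ⟨hT'.1 ha, haS⟩)
    · exact fun h => absurd hT h
  have hlist : listSpan K Y m B.card ≤ LinearMap.ker Ψ := by
    refine Submodule.span_le.2 ?_
    rintro e ⟨l, hl, hlen, rfl⟩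
    rw [SetLike.mem_coe, LinearMap.mem_ker]
    by_cases hn : l.Nodup
    · have hT : l.toFinset ∈ (range m).powersetCard B.card := by
        rw [Finset.mem_powersetCard, List.toFinset_card_of_nodup hn]
        refine ⟨fun a ha => ?_, hlen⟩
        simpa using hl a (by simpa using ha)
      rcases hYA.prod_eq_sortedProd hn with h | h <;> simp [h, hsorted _ hT]
    · rw [hYA.prod_eq_zero hn, map_zero]
  have hmem : L ^ B.card • sortedProd y B ∈ LinearMap.ker Ψ := by
    apply hlist
    have := pow_smul_list_prod_mem Y (fun c hc => det_smul_mem_span_comb A y m c hc)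
      (B.sort (· ≤ ·)) (by
        intro c hc
        have : c ∈ B := by simpa using hc
        simpa using hB this)
    rw [Finset.length_sort] at this
    exact this
  have hreg' : ∀ (j : ℕ) (e : E), L ^ j • e = 0 → e = 0 := by
    intro j
    induction j with
    | zero => simp
    | succ j ih =>
      intro e he
      rw [pow_succ', ← smul_smul] at he
      exact ih e (hreg _ he)
  have h0 : Ψ (sortedProd y B) = 0 := by
    rw [LinearMap.mem_ker, map_smul] at hmem
    exact hreg' _ _ hmem
  rw [hΨ, sub_eq_zero] at h0
  have h3 : ∀ S ∈ (range m).powersetCard B.card,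
      top (sortedProd y B * sortedProd Y (range m \ S)) =
        shuffleSign K B * minorDet A (range m \ B) (range m \ S) := by
    intro S hS
    have hS' := Finset.mem_powersetCard.1 hS
    rw [hy.sortedProd_mul_comb A hB, hy.sortedProd_mul_compl_smul (K := K) hB, map_smul,
      map_smul, htop]
    · simp [mul_comm]
    · rw [Finset.card_sdiff_of_subset hS'.1, Finset.card_sdiff_of_subset hB, hS'.2]
  rw [← h0, Finset.smul_sum]
  refine Finset.sum_congr rfl fun S hS => ?_
  rw [h3 S hS]
  simp only [smul_smul]
  congr 1
  linear_combination (-shuffleSign K S * minorDet A (range m \ B) (range m \ S)) *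
    shuffleSign_mul_self (K := K) B

end Laplace

section TensorStructure

variable {F : Type} [Field F] {n : ℕ}

/-- The exterior generator `y_a` in `S(V) ⊗ Λ(V)`. -/
def yT (F : Type) [Field F] (n a : ℕ) : SL F n := 1 ⊗ₜ[F] yV F n a

theorem yV_eq_ι (F : Type) [Field F] (n a : ℕ) : ∃ v, yV F n a = ExteriorAlgebra.ι F v := by
  unfold yV
  split_ifs with h
  · exact ⟨_, rfl⟩
  · exact ⟨0, (map_zero _).symm⟩

theorem anticomm_yV (F : Type) [Field F] (n : ℕ) : Anticomm (yV F n) := by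
  refine ⟨fun a => ?_, fun a b => ?_⟩
  · obtain ⟨v, hv⟩ := yV_eq_ι F n a
    rw [hv, ExteriorAlgebra.ι_sq_zero]
  · obtain ⟨v, hv⟩ := yV_eq_ι F n a
    obtain ⟨w, hw⟩ := yV_eq_ι F n b
    rw [hv, hw]
    exact eq_neg_of_add_eq_zero_left (ExteriorAlgebra.ι_add_mul_swap v w)

theorem anticomm_yT (F : Type) [Field F] (n : ℕ) : Anticomm (yT F n) := by
  refine ⟨fun a => ?_, fun a b => ?_⟩
  · rw [yT, Algebra.TensorProduct.tmul_mul_tmul, (anticomm_yV F n).1, TensorProduct.tmul_zero]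
  · rw [yT, yT, Algebra.TensorProduct.tmul_mul_tmul, Algebra.TensorProduct.tmul_mul_tmul,
      (anticomm_yV F n).2, TensorProduct.tmul_neg]

theorem tmul_yProd (S : Finset ℕ) : (1 : SV F n) ⊗ₜ[F] yProd F n S = sortedProd (yT F n) S :=
  sortedProd_map (Algebra.TensorProduct.includeRight : LV F n →ₐ[F] SL F n) (yV F n) S

theorem yProd_map_val (T : Finset (Fin n)) :
    yProd F n (T.map Fin.valEmbedding) = (Pi.basisFun F (Fin n)).ExteriorAlgebra T := by
  change sortedProd (yV F n) _ = _
  rw [ExteriorAlgebra.basis_apply_ofCard _ rfl, sortedProd_eq_ofFn _ _ (T.card_map _),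
    ExteriorAlgebra.ιMulti_family, ExteriorAlgebra.ιMulti_apply]
  congr 1
  congr 1
  funext i
  have h : (T.map Fin.valEmbedding).orderEmbOfFin (T.card_map _) i = (T.orderEmbOfFin rfl i : ℕ) := by
    have := Finset.orderEmbOfFin_unique (s := T.map Fin.valEmbedding) (T.card_map _)
      (f := fun i => (T.orderEmbOfFin rfl i : ℕ)) (fun x => by
        exact Finset.mem_map.2 ⟨_, T.orderEmbOfFin_mem rfl x, rfl⟩)
      (fun a b h => (T.orderEmbOfFin rfl).strictMono h)
    exact (congrFun this i).symm
  rw [h, yV, dif_pos (T.orderEmbOfFin rfl i).2]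
  simp [Set.powersetCard.ofFinEmbEquiv_symm_apply, Set.powersetCard.ofCard]

/-- The basis of `S(V) ⊗ Λ(V)` over `S(V)` given by the products of the `y_a`. -/
def slBasis (F : Type) [Field F] (n : ℕ) : Module.Basis (Finset (Fin n)) (SV F n) (SL F n) :=
  Algebra.TensorProduct.basis (SV F n) (Pi.basisFun F (Fin n)).ExteriorAlgebra

theorem slBasis_apply (T : Finset (Fin n)) :
    slBasis F n T = sortedProd (yT F n) (T.map Fin.valEmbedding) := by
  rw [slBasis, Algebra.TensorProduct.basis_apply, ← yProd_map_val, tmul_yProd]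

theorem map_val_subset (T : Finset (Fin n)) : T.map Fin.valEmbedding ⊆ range n := by
  intro a ha
  obtain ⟨b, _, rfl⟩ := Finset.mem_map.1 ha
  simp

theorem exists_map_val {B : Finset ℕ} (hB : B ⊆ range n) :
    ∃ T : Finset (Fin n), T.map Fin.valEmbedding = B :=
  ⟨Finset.univ.filter fun i => (i : ℕ) ∈ B, by
    ext a
    simp only [Finset.mem_map, Finset.mem_filter, Finset.mem_univ, true_and,
      Fin.valEmbedding_apply]
    exact ⟨fun ⟨b, hb, h⟩ => h ▸ hb, fun h => ⟨⟨a, by simpa using hB h⟩, h, rfl⟩⟩⟩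

theorem exists_top {B : Finset ℕ} (hB : B ⊆ range n) :
    ∃ top : SL F n →ₗ[SV F n] SV F n, top (sortedProd (yT F n) B) = 1 := by
  obtain ⟨T, rfl⟩ := exists_map_val hB
  refine ⟨(slBasis F n).coord T, ?_⟩
  rw [← slBasis_apply]
  simp

theorem sl_smul_eq_zero {s : SV F n} {e : SL F n} (hs : s ≠ 0) (h : s • e = 0) : e = 0 := by
  apply (slBasis F n).repr.injective
  have h' := congrArg (slBasis F n).repr h
  rw [map_smul, map_zero] at h'
  rw [map_zero]
  ext1 T
  have := congrArg (fun f => f T) h'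
  simpa [hs] using this

theorem tmul_one_mul (s : SV F n) (e : SL F n) : (s ⊗ₜ[F] (1 : LV F n)) * e = s • e := by
  exact (Algebra.smul_def s e).symm

theorem tmul_one_eq_smul (s : SV F n) : (s ⊗ₜ[F] (1 : LV F n)) = s • (1 : SL F n) := by
  rw [← tmul_one_mul, mul_one]

/-- The algebra map `Λ(V) → S(V) ⊗ Λ(V)` sending `y_a` to `w a`. -/
def extHomAux (w : ℕ → SL F n) (hw : Anticomm w) : LV F n →ₐ[F] SL F n :=
  ExteriorAlgebra.lift F (⟨Fintype.linearCombination F (fun i : Fin n => w i), fun v => by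
    refine hw.mul_self_of_mem_span (K := F) ?_
    rw [Fintype.linearCombination_apply]
    exact Submodule.sum_mem _ fun c _ => Submodule.smul_mem _ _
      (Submodule.subset_span (Set.mem_range_self _))⟩ :
    {f : (Fin n → F) →ₗ[F] SL F n // ∀ m, f m * f m = 0})

theorem extHomAux_commute (w : ℕ → SL F n) (hw : Anticomm w) (s : SV F n) (e : LV F n) :
    Commute (Algebra.ofId (SV F n) (SL F n) s) (extHomAux w hw e) :=
  Algebra.commutes s (extHomAux w hw e)

/-- The `S(V)`-algebra endomorphism of `S(V) ⊗ Λ(V)` sending `y_a` to `w a`. -/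
def extHom (w : ℕ → SL F n) (hw : Anticomm w) : SL F n →ₐ[SV F n] SL F n :=
  Algebra.TensorProduct.lift (Algebra.ofId (SV F n) (SL F n))
    (extHomAux w hw) (extHomAux_commute w hw)

theorem extHom_yT (w : ℕ → SL F n) (hw : Anticomm w) {a : ℕ} (ha : a < n) :
    extHom w hw (yT F n a) = w a := by
  rw [yT, extHom, Algebra.TensorProduct.lift_tmul, map_one, one_mul, yV, dif_pos ha,
    extHomAux, ExteriorAlgebra.lift_ι_apply]
  simp

theorem extHom_sortedProd (w : ℕ → SL F n) (hw : Anticomm w) {B : Finset ℕ} (hB : B ⊆ range n) :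
    extHom w hw (sortedProd (yT F n) B) = sortedProd w B := by
  rw [sortedProd_map]
  exact sortedProd_congr fun a ha => extHom_yT w hw (by simpa using hB ha)

end TensorStructure

section Equivariance

variable {F : Type} [Field F] {n : ℕ}

/-- The action of a matrix on the first tensor factor only. -/
def sigma (g : Matrix (Fin n) (Fin n) F) : SL F n →ₐ[F] SL F n :=
  Algebra.TensorProduct.map (gAct F n g) (AlgHom.id F (LV F n))

theorem sigma_smul (g : Matrix (Fin n) (Fin n) F) (s : SV F n) (e : SL F n) :
    sigma g (s • e) = gAct F n g s • sigma g e := by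
  rw [← tmul_one_mul, map_mul, ← tmul_one_mul, sigma, Algebra.TensorProduct.map_tmul, map_one]

theorem sigma_yT (g : Matrix (Fin n) (Fin n) F) (a : ℕ) : sigma g (yT F n a) = yT F n a := by
  simp [sigma, yT]

theorem gAct_xV (g : Matrix (Fin n) (Fin n) F) (i : Fin n) :
    gAct F n g (xV F n i) = ∑ j : Fin n, g j i • xV F n j := by
  simp [gAct, xV, MvPolynomial.smul_eq_C_mul]

theorem sortedProd_smul {K E : Type*} [CommRing K] [Ring E] [Algebra K E] (L : K) (y : ℕ → E)
    (S : Finset ℕ) : sortedProd (fun a => L • y a) S = L ^ S.card • sortedProd y S := by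
  rw [← Finset.length_sort (· ≤ ·) (s := S), sortedProd, sortedProd]
  induction S.sort (· ≤ ·) with
  | nil => simp
  | cons a l ih => 
    rw [List.map_cons, List.prod_cons, ih, smul_mul_smul_comm, ← pow_succ', List.map_cons,
      List.prod_cons, List.length_cons]

variable [Fintype F]

/-- The matrix `(x_t ^ q ^ c)`. -/
def mooreA (F : Type) [Field F] [Fintype F] (n : ℕ) (c t : ℕ) : SV F n :=
  xV F n t ^ Fintype.card F ^ c

/-- The family `∑_c x_s ^ q ^ c • y_c`. -/
def mooreY (F : Type) [Field F] [Fintype F] (n : ℕ) : ℕ → SL F n :=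
  comb (mooreA F n) (range n) (yT F n)

theorem anticomm_mooreY (F : Type) [Field F] [Fintype F] (n : ℕ) : Anticomm (mooreY F n) :=
  (anticomm_yT F n).comb _ _

/-- The substitution `y_s ↦ ∑_c x_s ^ q ^ c • y_c`, turning the diagonal action into an action
on coefficients. -/
def phi (F : Type) [Field F] [Fintype F] (n : ℕ) : SL F n →ₐ[SV F n] SL F n :=
  extHom (mooreY F n) (anticomm_mooreY F n)

theorem pow_card_pow_eq {R : Type*} [CommRing R] [Algebra F R] (b : ℕ) (x : R) :
    ((FiniteField.frobeniusAlgHom F R) ^ b) x = x ^ Fintype.card F ^ b := by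
  rw [AlgHom.coe_pow, FiniteField.coe_frobeniusAlgHom, pow_iterate]

theorem gAct_mooreA (g : Matrix (Fin n) (Fin n) F) (c : ℕ) (i : Fin n) :
    gAct F n g (mooreA F n c i) = ∑ j : Fin n, g j i • mooreA F n c j := by
  simp only [mooreA, map_pow, gAct_xV]
  simp only [← pow_card_pow_eq (F := F), map_sum, map_smul]

theorem phi_tAct (g : Matrix (Fin n) (Fin n) F) (f : SL F n) :
    phi F n (tAct F n g f) = sigma g (phi F n f) := by
  suffices h : ((phi F n).restrictScalars F).comp (tAct F n g) =
      (sigma g).comp ((phi F n).restrictScalars F) from DFunLike.congr_fun h f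
  apply Algebra.TensorProduct.ext
  · ext1 i
    have h1 : ∀ s : SV F n, phi F n (s ⊗ₜ[F] 1) = s ⊗ₜ[F] 1 := fun s => (phi F n).commutes s
    change phi F n (tAct F n g (X i ⊗ₜ[F] 1)) = sigma g (phi F n (X i ⊗ₜ[F] 1))
    rw [h1, tAct, sigma, Algebra.TensorProduct.map_tmul, Algebra.TensorProduct.map_tmul, map_one,
      map_one, h1]
  · apply ExteriorAlgebra.hom_ext
    refine (Pi.basisFun F (Fin n)).ext fun i => ?_
    have hy : ∀ j : Fin n, (1 : SV F n) ⊗ₜ[F] ExteriorAlgebra.ι F (Pi.single j (1 : F)) =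
        yT F n j := by
      intro j
      simp [yT, yV]
    have h2 : tAct F n g (yT F n i) = ∑ j : Fin n, g j i • yT F n j := by
      rw [← hy, tAct, Algebra.TensorProduct.map_tmul, map_one, eAct,
        ExteriorAlgebra.map_apply_ι]
      have : g.mulVecLin (Pi.single i 1) = ∑ j : Fin n, g j i • Pi.single j (1 : F) := by
        ext a
        simp [Pi.single_apply]
      rw [this, map_sum, TensorProduct.tmul_sum]
      simp only [map_smul, TensorProduct.tmul_smul, hy]
    change phi F n (tAct F n g (1 ⊗ₜ[F] ExteriorAlgebra.ι F (Pi.basisFun F (Fin n) i))) =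
      sigma g (phi F n (1 ⊗ₜ[F] ExteriorAlgebra.ι F (Pi.basisFun F (Fin n) i)))
    rw [Pi.basisFun_apply, hy, h2, map_sum]
    have h3 : ∀ j : Fin n, phi F n (yT F n j) = mooreY F n j := fun j => extHom_yT _ _ j.2
    have h4 : ∀ (c : F) (e : SL F n), phi F n (c • e) = c • phi F n e := fun c e =>
      map_smul ((phi F n).restrictScalars F) c e
    simp only [h4, h3, mooreY, comb, map_sum, sigma_smul, sigma_yT, gAct_mooreA, Finset.smul_sum,
      Finset.sum_smul, smul_assoc]
    rw [Finset.sum_comm]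

theorem phi_injective (h : minorDet (mooreA F n) (range n) (range n) ≠ 0) :
    Function.Injective (phi F n) := by
  set A' : Matrix (Fin n) (Fin n) (SV F n) := Matrix.of fun i j : Fin n => mooreA F n i j with hA'
  have hdet : A'.det ≠ 0 := by rwa [minorDet_range] at h
  let adj : ℕ → ℕ → SV F n := fun t c =>
    if ht : t < n then if hc : c < n then A'.adjugate ⟨t, ht⟩ ⟨c, hc⟩ else 0 else 0
  have hadj : ∀ t c : Fin n, adj t c = A'.adjugate t c := by intro t c; simp [adj]
  let v := comb adj (range n) (yT F n)
  have hv : Anticomm v := (anticomm_yT F n).comb _ _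
  have h1 : ∀ s < n, extHom v hv (mooreY F n s) = A'.det • yT F n s := by
    intro s hs
    simp only [mooreY, comb, map_sum, map_smul]
    have : ∀ c ∈ range n, mooreA F n c s • extHom v hv (yT F n c) = mooreA F n c s • v c := by
      intro c hc
      rw [extHom_yT v hv (by simpa using hc)]
    rw [Finset.sum_congr rfl this]
    simp only [v, comb, Finset.smul_sum, smul_smul]
    rw [Finset.sum_comm]
    simp only [← Finset.sum_smul]
    have h2 : ∀ t : Fin n, ∑ c : Fin n, mooreA F n c s * adj t c =
        (A'.adjugate * A') t ⟨s, hs⟩ := by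
      intro t
      rw [Matrix.mul_apply]
      exact Finset.sum_congr rfl fun c _ => by rw [hadj, mul_comm]; rfl
    rw [Finset.sum_range]
    have h3 : ∀ t : Fin n, ∑ c ∈ range n, mooreA F n c s * adj t c =
        (A'.adjugate * A') t ⟨s, hs⟩ := fun t => by rw [Finset.sum_range, h2]
    simp only [h3, Matrix.adjugate_mul, Matrix.smul_apply, Matrix.one_apply]
    rw [Finset.sum_eq_single ⟨s, hs⟩]
    · simp
    · intro b _ hb
      simp [hb]
    · simp
  have h2 : ∀ B ⊆ range n, extHom v hv (phi F n (sortedProd (yT F n) B)) =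
      A'.det ^ B.card • sortedProd (yT F n) B := by
    intro B hB
    rw [phi, extHom_sortedProd _ _ hB, sortedProd_map, ← sortedProd_smul]
    exact sortedProd_congr fun a ha => h1 a (by simpa using hB ha)
  rw [injective_iff_map_eq_zero]
  intro f hf
  have h3 : extHom v hv (phi F n f) = 0 := by rw [hf, map_zero]
  rw [← (slBasis F n).sum_repr f] at h3
  simp only [map_sum, map_smul, slBasis_apply, h2 _ (map_val_subset _), smul_smul] at h3
  apply (slBasis F n).repr.injective
  rw [map_zero]
  ext1 T
  have h4 := Fintype.linearIndependent_iff.1 (slBasis F n).linearIndependent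
    (fun T => (slBasis F n).repr f T * A'.det ^ (T.map Fin.valEmbedding).card)
    (by simpa only [slBasis_apply] using h3) T
  simpa [hdet] using h4

end Equivariance

section DicksonPolynomials

variable {F : Type} [Field F] [Fintype F]

theorem prod_add_algebraMap_mul_field {K : Type*} [Field K] [Algebra F K] (y z : K) :
    ∏ a : F, (algebraMap F K a * z + y) =
      y ^ Fintype.card F - z ^ (Fintype.card F - 1) * y := by
  have hq : 1 < Fintype.card F := Fintype.one_lt_card
  by_cases hz : z = 0
  · have h1 : Fintype.card F - 1 ≠ 0 := by omega
    simp [hz, h1]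
  have h1 : ∏ a : F, (Polynomial.X - Polynomial.C a) =
      (Polynomial.X ^ Fintype.card F - Polynomial.X : Polynomial F) := by
    have h2 := Polynomial.prod_multiset_X_sub_C_of_monic_of_roots_card_eq
      (p := (Polynomial.X ^ Fintype.card F - Polynomial.X : Polynomial F))
      (Polynomial.monic_X_pow_sub (by simpa using hq))
      (by
        rw [FiniteField.roots_X_pow_card_sub_X, FiniteField.X_pow_card_sub_X_natDegree_eq _ hq]
        rfl)
    rw [FiniteField.roots_X_pow_card_sub_X] at h2
    exact h2
  have h2 := congrArg (Polynomial.aeval (y / z)) h1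
  simp only [map_prod, map_sub, Polynomial.aeval_X, Polynomial.aeval_C, map_pow] at h2
  have h3 : ∏ a : F, (algebraMap F K a * z + y) = ∏ a : F, z * (y / z - algebraMap F K a) := by
    rw [← Equiv.prod_comp (Equiv.neg F)]
    refine Finset.prod_congr rfl fun a _ => ?_
    simp only [Equiv.neg_apply, map_neg]
    field_simp
    ring
  rw [h3, Finset.prod_mul_distrib, h2, Finset.prod_const, Finset.card_univ]
  obtain ⟨q, hq'⟩ : ∃ q, Fintype.card F = q + 1 := ⟨Fintype.card F - 1, by omega⟩
  rw [hq', div_pow, mul_sub]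
  simp only [Nat.add_sub_cancel]
  field_simp
  ring

variable {R : Type*} [CommRing R] [Algebra F R]

/-- The product of all `X + v` for `v` in the span of `z 0, …, z (m - 1)`. -/
def gp (F : Type) [Field F] [Fintype F] {R : Type*} [CommRing R] [Algebra F R] (z : ℕ → R) (m : ℕ)
    (x : R) : R :=
  ∏ c : Fin m → F, ((∑ k, c k • z k) + x)

theorem gp_zero (z : ℕ → R) (x : R) : gp F z 0 x = x := by
  simp [gp]

theorem gp_succ (z : ℕ → R) (m : ℕ) (x : R) :
    gp F z (m + 1) x = ∏ a : F, gp F z m (a • z m + x) := by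
  unfold gp
  rw [← (Fin.snocEquiv fun _ : Fin (m + 1) => F).prod_comp, Fintype.prod_prod_type]
  refine Finset.prod_congr rfl fun a _ => Finset.prod_congr rfl fun c _ => ?_
  simp [Fin.snocEquiv, Fin.sum_univ_castSucc, add_assoc]

theorem pow_card_pow_add (b : ℕ) (x y : R) :
    (x + y) ^ Fintype.card F ^ b = x ^ Fintype.card F ^ b + y ^ Fintype.card F ^ b := by
  simp only [← pow_card_pow_eq (F := F), map_add]

theorem pow_card_pow_sum {ι : Type*} (s : Finset ι) (b : ℕ) (x : ι → R) :
    (∑ i ∈ s, x i) ^ Fintype.card F ^ b = ∑ i ∈ s, x i ^ Fintype.card F ^ b := by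
  simp only [← pow_card_pow_eq (F := F), map_sum]

theorem pow_card_pow_smul (b : ℕ) (a : F) (x : R) :
    (a • x) ^ Fintype.card F ^ b = a • x ^ Fintype.card F ^ b := by
  simp only [← pow_card_pow_eq (F := F), map_smul]

theorem gp_self (z : ℕ → R) {m t : ℕ} (ht : t < m) : gp F z m (z t) = 0 := by
  unfold gp
  refine Finset.prod_eq_zero (Finset.mem_univ (Pi.single ⟨t, ht⟩ (-1))) ?_
  simp [Pi.single_apply, ite_smul]

theorem sum_mul_succ (f g : ℕ → R) (N : ℕ) : ∑ c ∈ range N, f c * g (c + 1) =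
    ∑ c ∈ range (N + 1), (if c = 0 then 0 else f (c - 1)) * g c := by
  rw [Finset.sum_range_succ']
  simp

theorem gp_linear_of {z : ℕ → R} {m : ℕ} {t : ℕ → R}
    (ht : ∀ x, gp F z m x = ∑ c ∈ range (m + 1), t c * x ^ Fintype.card F ^ c) (a : F) (x y : R) :
    gp F z m (a • x + y) = a • gp F z m x + gp F z m y := by
  simp only [ht, pow_card_pow_add, pow_card_pow_smul, mul_add, Finset.sum_add_distrib,
    Finset.smul_sum, mul_smul_comm]

variable [IsDomain R]

theorem prod_smul_add (y z : R) :
    ∏ a : F, (a • z + y) = y ^ Fintype.card F - z ^ (Fintype.card F - 1) * y := by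
  apply IsFractionRing.injective R (FractionRing R)
  have := prod_add_algebraMap_mul_field (F := F) (algebraMap R (FractionRing R) y)
    (algebraMap R (FractionRing R) z)
  simp only [map_prod, map_sub, map_add, map_mul, map_pow, Algebra.smul_def,
    ← IsScalarTower.algebraMap_apply]
  exact this

theorem exists_gp_eq (z : ℕ → R) (m : ℕ) : ∃ t : ℕ → R, t m = 1 ∧ t (m + 1) = 0 ∧
    ∀ x, gp F z m x = ∑ c ∈ range (m + 1), t c * x ^ Fintype.card F ^ c := by
  induction m with
  | zero => exact ⟨fun c => if c = 0 then 1 else 0, by simp, by simp, by simp [gp_zero]⟩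
  | succ m ih =>
    obtain ⟨t, h1, h2, h3⟩ := ih
    set Z := gp F z m (z m) ^ (Fintype.card F - 1) with hZ
    let t' : ℕ → R := fun c => if c ≤ m then t c else 0
    refine ⟨fun c => (if c = 0 then 0 else t' (c - 1) ^ Fintype.card F) - Z * t' c,
      by simp [t', h1], ?_, fun x => ?_⟩
    · have : Fintype.card F ≠ 0 := Fintype.card_ne_zero
      simp [t', this]
    · have ht' : ∀ c ∈ range (m + 1), t c = t' c := by
        intro c hc
        simp only [t']
        rw [if_pos (by simpa [Nat.lt_succ_iff] using hc)]
      have h3' : ∀ x, gp F z m x = ∑ c ∈ range (m + 1), t' c * x ^ Fintype.card F ^ c := by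
        intro x
        rw [h3]
        exact Finset.sum_congr rfl fun c hc => by rw [ht' c hc]
      have h4 : gp F z (m + 1) x = gp F z m x ^ Fintype.card F - Z * gp F z m x := by
        rw [gp_succ]
        simp only [gp_linear_of h3]
        rw [prod_smul_add]
      have h5 : gp F z m x ^ Fintype.card F =
          ∑ c ∈ range (m + 1), t' c ^ Fintype.card F * x ^ Fintype.card F ^ (c + 1) := by
        have := pow_card_pow_sum (F := F) (range (m + 1)) 1
          (fun c => t' c * x ^ Fintype.card F ^ c)
        simp only [pow_one] at this
        rw [h3', this]
        exact Finset.sum_congr rfl fun c _ => by rw [mul_pow, ← pow_mul, ← pow_succ]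
      have h6 : gp F z m x = ∑ c ∈ range (m + 1 + 1), t' c * x ^ Fintype.card F ^ c := by
        rw [Finset.sum_range_succ, h3']
        simp [t']
      rw [h4, h5]
      nth_rewrite 1 [h6]
      simp only [sub_mul, Finset.sum_sub_distrib]
      congr 1
      · exact sum_mul_succ (fun c => t' c ^ Fintype.card F) (fun c => x ^ Fintype.card F ^ c) (m + 1)
      · simp only [Finset.mul_sum, mul_assoc]

theorem gp_smul_add (z : ℕ → R) (m : ℕ) (a : F) (x y : R) :
    gp F z m (a • x + y) = a • gp F z m x + gp F z m y := by
  obtain ⟨t, _, _, h⟩ := exists_gp_eq (F := F) z m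
  exact gp_linear_of h a x y

theorem gp_comp (z : ℕ → R) (m a : ℕ) (x : R) :
    gp F (fun k => gp F z m (z (m + k))) a (gp F z m x) = gp F z (m + a) x := by
  induction a generalizing x with
  | zero => simp [gp_zero]
  | succ a ih =>
    rw [gp_succ, ← add_assoc, gp_succ]
    refine Finset.prod_congr rfl fun c _ => ?_
    rw [← gp_smul_add, ih]

theorem moore_det (z : ℕ → R) (m : ℕ) :
    Matrix.det (Matrix.of fun c t : Fin m => z t ^ Fintype.card F ^ (c : ℕ)) =
      ∏ a ∈ range m, gp F z a (z a) := by
  induction m with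
  | zero => simp
  | succ m ih =>
    set M : Matrix (Fin (m + 1)) (Fin (m + 1)) R :=
      Matrix.of fun c t : Fin (m + 1) => z t ^ Fintype.card F ^ (c : ℕ) with hM
    obtain ⟨t, h1, _, h3⟩ := exists_gp_eq (F := F) z m
    have h4 := Matrix.det_updateRow_sum M (Fin.last m) (fun c => t c)
    have h5 : ∑ k : Fin (m + 1), t k • M k = fun s : Fin (m + 1) => gp F z m (z s) := by
      funext s
      rw [h3, Finset.sum_range]
      simp [hM, Finset.sum_apply]
    rw [h5, Fin.val_last, h1, one_smul] at h4
    rw [← h4, Matrix.det_succ_row _ (Fin.last m), Finset.sum_eq_single (Fin.last m)]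
    · rw [Finset.prod_range_succ, ← ih, Matrix.updateRow_self, Fin.val_last, ← two_mul, pow_mul,
        neg_one_sq, one_pow, one_mul, mul_comm]
      congr 2
      ext i j
      simp [hM, Matrix.updateRow_apply, (Fin.castSucc_lt_last i).ne]
    · intro s _ hs
      rw [Matrix.updateRow_self, gp_self]
      · simp
      · exact Fin.val_lt_last hs
    · simp

theorem exists_pow_eq_sum (z : ℕ → R) (m b : ℕ) : ∃ T : ℕ → R, ∀ s < m,
    z s ^ Fintype.card F ^ b = ∑ c ∈ range m, T c * z s ^ Fintype.card F ^ c := by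
  cases m with
  | zero => exact ⟨0, by simp⟩
  | succ m =>
    obtain ⟨t, h1, _, h3⟩ := exists_gp_eq (F := F) z (m + 1)
    have ht : ∀ s < m + 1, z s ^ Fintype.card F ^ (m + 1) =
        -∑ c ∈ range (m + 1), t c * z s ^ Fintype.card F ^ c := by
      intro s hs
      have := h3 (z s)
      rw [gp_self z hs, Finset.sum_range_succ, h1] at this
      linear_combination -this
    induction b with
    | zero =>
      refine ⟨fun c => if c = 0 then 1 else 0, fun s _ => ?_⟩
      simp [ite_mul]
    | succ b ih =>
      obtain ⟨T, hT⟩ := ih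
      refine ⟨fun c => (if c = 0 then 0 else T (c - 1) ^ Fintype.card F) -
        T m ^ Fintype.card F * t c, fun s hs => ?_⟩
      have h5 : z s ^ Fintype.card F ^ (b + 1) =
          ∑ c ∈ range (m + 1), T c ^ Fintype.card F * z s ^ Fintype.card F ^ (c + 1) := by
        have := pow_card_pow_sum (F := F) (range (m + 1)) 1
          (fun c => T c * z s ^ Fintype.card F ^ c)
        simp only [pow_one] at this
        rw [pow_succ, pow_mul, hT s hs, this]
        exact Finset.sum_congr rfl fun c _ => by rw [mul_pow, ← pow_mul, ← pow_succ]
      rw [h5, Finset.sum_range_succ, ht s hs]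
      simp only [sub_mul, Finset.sum_sub_distrib]
      have h6 := sum_mul_succ (fun c => T c ^ Fintype.card F)
        (fun c => z s ^ Fintype.card F ^ c) m
      rw [h6, mul_neg, ← sub_eq_add_neg]
      simp only [Finset.mul_sum, mul_assoc]

end DicksonPolynomials

section GroupAction

variable {F : Type} [Field F] {n : ℕ}

theorem gAct_mul (g h : Matrix (Fin n) (Fin n) F) (f : SV F n) :
    gAct F n (g * h) f = gAct F n g (gAct F n h f) := by
  suffices H : gAct F n (g * h) = (gAct F n g).comp (gAct F n h) from DFunLike.congr_fun H f
  ext1 i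
  simp only [gAct, AlgHom.comp_apply, aeval_X, map_sum, map_mul, Matrix.mul_apply,
    Finset.sum_mul, Finset.mul_sum, MvPolynomial.algHom_C, MvPolynomial.algebraMap_eq]
  rw [Finset.sum_comm]
  exact Finset.sum_congr rfl fun j _ => Finset.sum_congr rfl fun k _ => by ring

theorem gAct_one (f : SV F n) : gAct F n 1 f = f := by
  suffices H : gAct F n 1 = AlgHom.id F _ from DFunLike.congr_fun H f
  ext1 i
  simp [gAct, Matrix.one_apply]

theorem gAct_injective {g : Matrix (Fin n) (Fin n) F} (hg : IsUnit g.det) :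
    Function.Injective (gAct F n g) := by
  refine Function.LeftInverse.injective (g := gAct F n g⁻¹) fun f => ?_
  rw [← gAct_mul, Matrix.nonsing_inv_mul _ hg, gAct_one]

variable [Fintype F]

theorem linProd_eq_gp (a t : ℕ) : linProd F n a t = gp F (xV F n) a (xV F n t) := by
  simp [linProd, gp, MvPolynomial.smul_eq_C_mul]

theorem minorDet_mooreA (m : ℕ) :
    minorDet (mooreA F n) (range m) (range m) = Lm F n m := by
  rw [minorDet_range, Lm]
  simp only [linProd_eq_gp]
  exact moore_det (xV F n) m

theorem linProd_ne_zero {a : ℕ} (ha : a < n) : linProd F n a a ≠ 0 := by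
  unfold linProd
  refine Finset.prod_ne_zero_iff.2 fun c _ h => ?_
  have := congrArg (MvPolynomial.eval (Pi.single (⟨a, ha⟩ : Fin n) (1 : F))) h
  simp only [map_add, map_sum, map_mul, eval_C, map_zero] at this
  rw [Finset.sum_eq_zero, xV, dif_pos ha, eval_X, Pi.single_eq_same, zero_add] at this
  · exact one_ne_zero this
  · intro k _
    have hk : (k : ℕ) < n := k.2.trans ha
    rw [xV, dif_pos hk, eval_X, Pi.single_eq_of_ne, mul_zero]
    intro h
    exact k.2.ne (congrArg Fin.val h)

theorem Lm_ne_zero {m : ℕ} (hm : m ≤ n) : Lm F n m ≠ 0 :=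
  Finset.prod_ne_zero_iff.2 fun a ha => linProd_ne_zero (by
    have := Finset.mem_range.1 ha
    omega)

theorem gAct_Lm (g : Matrix (Fin n) (Fin n) F) : gAct F n g (Lm F n n) = g.det • Lm F n n := by
  rw [← minorDet_mooreA, minorDet_range, AlgHom.map_det]
  have h : (gAct F n g).mapMatrix (Matrix.of fun i j : Fin n => mooreA F n i j) =
      (Matrix.of fun i j : Fin n => mooreA F n i j) * g.map (algebraMap F (SV F n)) := by
    ext1 i j
    rw [AlgHom.mapMatrix_apply, Matrix.map_apply, Matrix.of_apply, gAct_mooreA, Matrix.mul_apply]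
    exact Finset.sum_congr rfl fun k _ => by rw [Algebra.smul_def, mul_comm]; rfl
  rw [h, Matrix.det_mul, Algebra.smul_def, mul_comm, ← RingHom.mapMatrix_apply, RingHom.map_det]

theorem theta_eq (I : Composition n) (i : Fin I.length) :
    theta F n I i =
      ∏ a ∈ range (I.blocksFun i), linProd F n (I.sizeUpTo i + a) (I.sizeUpTo i + a) := by
  rw [theta, Lm, map_prod]
  refine Finset.prod_congr rfl fun a ha => ?_
  have ha' : a < I.blocksFun i := Finset.mem_range.1 ha
  have hx : ∀ k < I.blocksFun i, aeval (fun t : Fin (I.blocksFun i) => vij F n I i t)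
      (xV F (I.blocksFun i) k) =
      gp F (xV F n) (I.sizeUpTo i) (xV F n (I.sizeUpTo i + k)) := by
    intro k hk
    rw [xV, dif_pos hk, aeval_X, vij, linProd_eq_gp]
  have h1 := gp_comp (F := F) (xV F n) (I.sizeUpTo i) a (xV F n (I.sizeUpTo i + a))
  rw [linProd_eq_gp, linProd_eq_gp, ← h1]
  unfold gp
  rw [map_prod]
  refine Finset.prod_congr rfl fun c _ => ?_
  rw [map_add, hx a ha', map_sum]
  congr 1
  refine Finset.sum_congr rfl fun k _ => ?_
  rw [map_smul, hx k (k.2.trans ha')]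
  rfl

theorem prod_theta_lt (I : Composition n) (j : ℕ) (hj : j ≤ I.length) :
    ∏ i ∈ Finset.univ.filter (fun i : Fin I.length => (i : ℕ) < j), theta F n I i =
      Lm F n (I.sizeUpTo j) := by
  induction j with
  | zero => simp [Lm]
  | succ j ih =>
    have hj' : j < I.length := hj
    have h1 : Finset.univ.filter (fun i : Fin I.length => (i : ℕ) < j + 1) =
        insert ⟨j, hj'⟩ (Finset.univ.filter (fun i : Fin I.length => (i : ℕ) < j)) := by
      ext i
      simp only [Finset.mem_filter, Finset.mem_univ, true_and, Finset.mem_insert, Fin.ext_iff]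
      omega
    have h2 := I.sizeUpTo_succ' ⟨j, hj'⟩
    simp only at h2
    rw [h1, Finset.prod_insert (by simp), ih hj'.le, h2, theta_eq, Lm, Lm, Finset.prod_range_add,
      mul_comm]

theorem prod_theta (I : Composition n) : ∏ i, theta F n I i = Lm F n n := by
  have := prod_theta_lt (F := F) I I.length le_rfl
  rw [I.sizeUpTo_length] at this
  rw [← this]
  exact Finset.prod_congr (by ext i; simp) fun _ _ => rfl

theorem prod_theta_pow (I : Composition n) (i : Fin I.length) (e : ℕ) :
    Lm F n (I.sizeUpTo (i + 1)) *
      ∏ i', theta F n I i' ^ (if i' ≤ i then e else e + 1) = Lm F n n ^ (e + 1) := by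
  rw [← prod_theta I, ← prod_theta_lt I (i + 1) i.2, Finset.prod_filter, ← Finset.prod_mul_distrib,
    ← Finset.prod_pow]
  refine Finset.prod_congr rfl fun i' _ => ?_
  by_cases h : i' ≤ i
  · have : (i' : ℕ) < i + 1 := Nat.lt_succ_of_le h
    rw [if_pos h, if_pos this, pow_succ']
  · have : ¬ (i' : ℕ) < i + 1 := fun h' => h (Nat.le_of_lt_succ h')
    rw [if_neg h, if_neg this, one_mul]

/-- The matrix expressing `x_s ^ q ^ b` through `x_s ^ q ^ c`, `c < m`, for all `s < m`. -/
theorem exists_reduction (F : Type) [Field F] [Fintype F] (n m : ℕ) : ∃ T : ℕ → ℕ → SV F n,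
    (∀ c b, b < m → T c b = if c = b then 1 else 0) ∧
    ∀ b s, s < m → mooreA F n b s = ∑ c ∈ range m, T c b * mooreA F n c s := by
  choose T hT using exists_pow_eq_sum (F := F) (xV F n) m
  refine ⟨fun c b => if b < m then (if c = b then 1 else 0) else T b c, fun c b hb => ?_,
    fun b s hs => ?_⟩
  · exact if_pos hb
  · by_cases hb : b < m
    · simp [hb, ite_mul]
    · simp only [hb, if_false]
      exact hT b s hs

theorem gAct_reduction {m : ℕ} (hm : m ≤ n) {T : ℕ → ℕ → SV F n}
    (hT : ∀ b s, s < m → mooreA F n b s = ∑ c ∈ range m, T c b * mooreA F n c s)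
    {g : Matrix (Fin n) (Fin n) F} (hg : IsUnit g.det)
    (hg0 : ∀ j i : Fin n, (i : ℕ) < m → m ≤ j → g j i = 0) {c b : ℕ} (hc : c < m) :
    gAct F n g (T c b) = T c b := by
  have key : ∀ s : Fin m, ∑ c : Fin m, (gAct F n g (T c b) - T c b) *
      gAct F n g (mooreA F n c s) = 0 := by
    intro s
    have hs : (s : ℕ) < n := s.2.trans_le hm
    have hlin : ∀ b, gAct F n g (mooreA F n b s) =
        ∑ j : Fin n, g j ⟨s, hs⟩ • mooreA F n b j := fun b => gAct_mooreA g b ⟨s, hs⟩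
    have h1 := congrArg (gAct F n g) (hT b s s.2)
    have h2 : gAct F n g (mooreA F n b s) =
        ∑ c ∈ range m, T c b * gAct F n g (mooreA F n c s) := by
      simp only [hlin, Finset.mul_sum]
      rw [Finset.sum_comm]
      refine Finset.sum_congr rfl fun j _ => ?_
      by_cases hj : (j : ℕ) < m
      · rw [hT b j hj, Finset.smul_sum]
        exact Finset.sum_congr rfl fun c _ => (mul_smul_comm _ _ _).symm
      · rw [hg0 j ⟨s, hs⟩ s.2 (not_lt.1 hj)]
        simp
    rw [h2, map_sum, ← sub_eq_zero, ← Finset.sum_sub_distrib, Finset.sum_range] at h1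
    rw [← neg_eq_zero, ← Finset.sum_neg_distrib, ← h1]
    refine Finset.sum_congr rfl fun c _ => ?_
    rw [map_mul]
    ring
  set M : Matrix (Fin m) (Fin m) (SV F n) :=
    (gAct F n g).mapMatrix (Matrix.of fun c s : Fin m => mooreA F n c s) with hM
  have hdet : M.det ≠ 0 := by
    rw [hM, ← AlgHom.map_det, ← minorDet_range, minorDet_mooreA]
    intro h
    exact Lm_ne_zero hm (gAct_injective hg (by rw [h, map_zero]))
  have hv := Matrix.eq_zero_of_vecMul_eq_zero hdet
    (v := fun c : Fin m => gAct F n g (T c b) - T c b) (funext fun s => key s)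
  exact sub_eq_zero.1 (congrFun hv ⟨c, hc⟩)

end GroupAction

section MuiImage

variable {F : Type} [Field F] {n : ℕ}

/-- The family `w_c = ∑_b T c b • y_b`. -/
def wV (T : ℕ → ℕ → SV F n) : ℕ → SL F n := comb (fun b c => T c b) (range n) (yT F n)

theorem anticomm_wV (T : ℕ → ℕ → SV F n) : Anticomm (wV T) := (anticomm_yT F n).comb _ _

variable [Fintype F]

theorem mooreY_eq_comb_wV {m : ℕ} {T : ℕ → ℕ → SV F n}
    (hT : ∀ b s, s < m → mooreA F n b s = ∑ c ∈ range m, T c b * mooreA F n c s) {s : ℕ}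
    (hs : s < m) : mooreY F n s = comb (mooreA F n) (range m) (wV T) s := by
  have h1 : mooreY F n s =
      ∑ b ∈ range n, (∑ c ∈ range m, T c b * mooreA F n c s) • yT F n b := by
    unfold mooreY comb
    exact Finset.sum_congr rfl fun b _ => by rw [hT b s hs]
  rw [h1]
  simp only [comb, wV, Finset.smul_sum, Finset.sum_smul, smul_smul]
  rw [Finset.sum_comm]
  exact Finset.sum_congr rfl fun c _ => Finset.sum_congr rfl fun b _ => by
    rw [mul_comm]

theorem MuiM_eq (m : ℕ) (B : Finset ℕ) : MuiM F (Fintype.card F) n m B =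
    ∑ S ∈ (range m).powersetCard B.card, shuffleSign (SV F n) S •
      minorDet (mooreA F n) (range m \ B) (range m \ S) • sortedProd (yT F n) S := by
  refine Finset.sum_congr rfl fun S hS => ?_
  rw [← tmul_yProd, ← (Finset.mem_powersetCard.1 hS).2, TensorProduct.smul_tmul',
    TensorProduct.smul_tmul', smul_eq_mul, mul_one, TensorProduct.smul_tmul', shuffleSign,
    smul_eq_mul, Algebra.smul_def, map_pow, map_neg, map_one]
  rfl

theorem phi_MuiM {m : ℕ} (hm : m ≤ n) {T : ℕ → ℕ → SV F n}
    (hT : ∀ b s, s < m → mooreA F n b s = ∑ c ∈ range m, T c b * mooreA F n c s) {B : Finset ℕ}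
    (hB : B ⊆ range m) : phi F n (MuiM F (Fintype.card F) n m B) =
      shuffleSign (SV F n) B • Lm F n m • sortedProd (wV T) B := by
  have hmn : range m ⊆ range n := Finset.range_subset_range.2 hm
  obtain ⟨top, htop⟩ := exists_top (F := F) hmn
  have h1 := (anticomm_yT F n).laplace m (mooreA F n) top htop
    (fun e he => sl_smul_eq_zero (by rw [minorDet_mooreA]; exact Lm_ne_zero hm) he) hB
  have h2 := congrArg (extHom (wV T) (anticomm_wV T)) h1
  simp only [map_sum, map_smul, minorDet_mooreA] at h2
  rw [extHom_sortedProd _ _ (hB.trans hmn)] at h2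
  rw [MuiM_eq, ← h2]
  simp only [map_sum, map_smul]
  refine Finset.sum_congr rfl fun S hS => ?_
  have hS' := (Finset.mem_powersetCard.1 hS).1
  congr 2
  rw [phi, extHom_sortedProd _ _ (hS'.trans hmn), sortedProd_map]
  refine sortedProd_congr fun s hs => ?_
  rw [mooreY_eq_comb_wV hT (Finset.mem_range.1 (hS' hs))]
  simp only [comb, map_sum, map_smul]
  refine Finset.sum_congr rfl fun c hc => ?_
  rw [extHom_yT _ _ (Finset.mem_range.1 (hmn hc))]

theorem sigma_wV {m : ℕ} (hm : m ≤ n) {T : ℕ → ℕ → SV F n}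
    (hT : ∀ b s, s < m → mooreA F n b s = ∑ c ∈ range m, T c b * mooreA F n c s)
    {g : Matrix (Fin n) (Fin n) F} (hg : IsUnit g.det)
    (hg0 : ∀ j i : Fin n, (i : ℕ) < m → m ≤ j → g j i = 0) {B : Finset ℕ} (hB : B ⊆ range m) :
    sigma g (sortedProd (wV T) B) = sortedProd (wV T) B := by
  rw [sortedProd_map]
  refine sortedProd_congr fun c hc => ?_
  simp only [wV, comb, map_sum, sigma_smul, sigma_yT]
  exact Finset.sum_congr rfl fun b _ => by
    rw [gAct_reduction hm hT hg hg0 (Finset.mem_range.1 (hB hc))]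

end MuiImage

section Triangularity

variable {K E : Type*} [CommRing K] [Ring E] [Algebra K E]

/-- The span of the products of the `y a` whose indices add up to at least `j`. -/
def weightFil (K : Type*) {E : Type*} [CommRing K] [Ring E] [Algebra K E] (y : ℕ → E) (j : ℕ) :
    Submodule K E :=
  Submodule.span K {e | ∃ l : List ℕ, j ≤ l.sum ∧ e = (l.map y).prod}

theorem weightFil_anti (y : ℕ → E) {i j : ℕ} (h : i ≤ j) : weightFil K y j ≤ weightFil K y i :=
  Submodule.span_mono fun _ ⟨l, hl, he⟩ => ⟨l, h.trans hl, he⟩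

theorem single_mem_weightFil (y : ℕ → E) {a j : ℕ} (h : j ≤ a) : y a ∈ weightFil K y j :=
  Submodule.subset_span ⟨[a], by simpa using h, by simp⟩

theorem weightFil_mul (y : ℕ → E) {i j : ℕ} {a b : E} (ha : a ∈ weightFil K y i)
    (hb : b ∈ weightFil K y j) : a * b ∈ weightFil K y (i + j) := by
  refine (Submodule.mul_le.2 ?_ : weightFil K y i * weightFil K y j ≤ _)
    (Submodule.mul_mem_mul ha hb)
  intro u hu v hv
  have h := Submodule.mul_mem_mul hu hv
  unfold weightFil at h
  rw [Submodule.span_mul_span] at h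
  refine Submodule.span_mono ?_ h
  rintro _ ⟨_, ⟨l, hl, rfl⟩, _, ⟨l', hl', rfl⟩, rfl⟩
  exact ⟨l ++ l', by rw [List.sum_append]; omega, by simp⟩

theorem list_prod_sub_mem_weightFil {y w : ℕ → E} (l : List ℕ)
    (h : ∀ c ∈ l, w c - y c ∈ weightFil K y (c + 1)) :
    (l.map w).prod - (l.map y).prod ∈ weightFil K y (l.sum + 1) := by
  induction l with
  | nil => simp
  | cons a l ih =>
    have h1 := ih fun c hc => h c (List.mem_cons_of_mem _ hc)
    have h2 := h a List.mem_cons_self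
    have h3 : (l.map w).prod ∈ weightFil K y l.sum := by
      rw [← sub_add_cancel (l.map w).prod (l.map y).prod]
      exact Submodule.add_mem _ (weightFil_anti y (Nat.le_succ _) h1)
        (Submodule.subset_span ⟨l, le_rfl, rfl⟩)
    have h4 : ((a :: l).map w).prod - ((a :: l).map y).prod =
        (w a - y a) * (l.map w).prod + y a * ((l.map w).prod - (l.map y).prod) := by
      simp only [List.map_cons, List.prod_cons]
      noncomm_ring
    rw [h4, List.sum_cons]
    refine Submodule.add_mem _ ?_ ?_
    · have := weightFil_mul y h2 h3
      rwa [add_right_comm] at this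
    · have := weightFil_mul y (single_mem_weightFil (K := K) y (le_refl a)) h1
      rwa [← add_assoc] at this

theorem sortedProd_sub_mem_weightFil {y w : ℕ → E} {B : Finset ℕ}
    (h : ∀ c ∈ B, w c - y c ∈ weightFil K y (c + 1)) :
    sortedProd w B - sortedProd y B ∈ weightFil K y (∑ b ∈ B, b + 1) := by
  have h1 := list_prod_sub_mem_weightFil (K := K) (y := y) (w := w) (B.sort (· ≤ ·))
    fun c hc => h c (by simpa using hc)
  have h2 : (B.sort (· ≤ ·)).sum = ∑ b ∈ B, b := by
    have := List.sum_toFinset (id : ℕ → ℕ) (B.sort_nodup (· ≤ ·))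
    rw [Finset.sort_toFinset] at this
    simpa using this.symm
  rw [h2] at h1
  exact h1

theorem Anticomm.weightFil_le {y : ℕ → E} (hy : Anticomm y) {n : ℕ} (hn : ∀ b, n ≤ b → y b = 0)
    (j : ℕ) : weightFil K y j ≤
      Submodule.span K {e | ∃ B ⊆ range n, j ≤ ∑ b ∈ B, b ∧ e = sortedProd y B} := by
  refine Submodule.span_le.2 ?_
  rintro _ ⟨l, hl, rfl⟩
  rw [SetLike.mem_coe]
  by_cases hl' : l.Nodup
  · by_cases hr : l.toFinset ⊆ range n
    · have hs : sortedProd y l.toFinset ∈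
          Submodule.span K {e | ∃ B ⊆ range n, j ≤ ∑ b ∈ B, b ∧ e = sortedProd y B} := by
        refine Submodule.subset_span ⟨_, hr, ?_, rfl⟩
        have := List.sum_toFinset (id : ℕ → ℕ) hl'
        rw [List.map_id] at this
        simp only [id] at this
        rwa [this]
      rcases hy.prod_eq_sortedProd hl' with h | h
      · rwa [h]
      · rw [h]
        exact Submodule.neg_mem _ hs
    · obtain ⟨b, hb, hb'⟩ := Finset.not_subset.1 hr
      have : (l.map y).prod = 0 :=
        List.prod_eq_zero (List.mem_map.2 ⟨b, by simpa using hb, hn b (by simpa using hb')⟩)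
      rw [this]
      exact Submodule.zero_mem _
  · rw [hy.prod_eq_zero hl']
    exact Submodule.zero_mem _

theorem Anticomm.sortedProd_mem_of_triangular {y : ℕ → E} (hy : Anticomm y) {n : ℕ}
    (hn : ∀ b, n ≤ b → y b = 0) (N : Submodule K E)
    (hN : ∀ B ⊆ range n, ∃ w ∈ N, w - sortedProd y B ∈ weightFil K y (∑ b ∈ B, b + 1))
    {B : Finset ℕ} (hB : B ⊆ range n) : sortedProd y B ∈ N := by
  obtain ⟨d, hd⟩ : ∃ d, (∑ b ∈ range n, b) - ∑ b ∈ B, b = d := ⟨_, rfl⟩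
  induction d using Nat.strong_induction_on generalizing B with
  | _ d ih =>
    obtain ⟨w, hw, hw'⟩ := hN B hB
    have h1 : w - sortedProd y B ∈ N := by
      refine (Submodule.span_le.2 ?_ : _ ≤ N) (hy.weightFil_le hn _ hw')
      rintro _ ⟨C, hC, hC', rfl⟩
      refine ih _ ?_ hC rfl
      have hle : ∑ b ∈ C, b ≤ ∑ b ∈ range n, b := Finset.sum_le_sum_of_subset hC
      omega
    rw [← sub_sub_cancel w (sortedProd y B)]
    exact Submodule.sub_mem _ hw h1

end Triangularity

section Combinatorics

variable {n : ℕ} (I : Composition n)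

theorem exists_mem_Adm {B : Finset ℕ} (hB : B ⊆ range n) (hne : B.Nonempty) :
    ∃ i : Fin I.length, (i, B) ∈ Adm n I := by
  have hm := B.max'_mem hne
  have hmn : B.max' hne < n := Finset.mem_range.1 (hB hm)
  refine ⟨I.index ⟨_, hmn⟩, ?_⟩
  simp only [Adm, Finset.mem_filter, Finset.mem_product, Finset.mem_univ, Finset.mem_powerset,
    true_and]
  refine ⟨hB, fun b hb => ?_, hne, _, hm, I.sizeUpTo_index_le ⟨_, hmn⟩⟩
  have h1 := I.lt_sizeUpTo_index_succ ⟨_, hmn⟩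
  exact Finset.mem_range.2 ((B.le_max' b hb).trans_lt h1)

theorem mem_Adm {x : Fin I.length × Finset ℕ} : x ∈ Adm n I ↔ x.2 ⊆ range n ∧
    x.2 ⊆ range (I.sizeUpTo ((x.1 : ℕ) + 1)) ∧ x.2.Nonempty ∧
      ∃ b ∈ x.2, I.sizeUpTo (x.1 : ℕ) ≤ b := by
  simp [Adm]

theorem Adm_snd_injOn : Set.InjOn Prod.snd (Adm n I : Set (Fin I.length × Finset ℕ)) := by
  have key : ∀ (i j : Fin I.length) (B : Finset ℕ), (i, B) ∈ Adm n I → (j, B) ∈ Adm n I →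
      ¬ i < j := by
    intro i j B hi hj hij
    obtain ⟨-, h1, -, -⟩ := (mem_Adm I).1 hi
    obtain ⟨-, -, -, b, hb, h2⟩ := (mem_Adm I).1 hj
    have h3 := Finset.mem_range.1 (h1 hb)
    have h4 : I.sizeUpTo (i + 1) ≤ I.sizeUpTo j := I.monotone_sizeUpTo hij
    simp only at h2 h3
    omega
  rintro ⟨i, B⟩ hi ⟨j, C⟩ hj h
  obtain rfl : B = C := h
  rw [Finset.mem_coe] at hi hj
  rw [Prod.mk.injEq]
  exact ⟨le_antisymm (not_lt.1 (key j i B hj hi)) (not_lt.1 (key i j B hi hj)), rfl⟩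

theorem one_add_card_Adm : 1 + (Adm n I).card = 2 ^ n := by
  have h1 : (Adm n I).image Prod.snd = (range n).powerset.erase ∅ := by
    ext B
    simp only [Finset.mem_image, Finset.mem_erase, Finset.mem_powerset]
    constructor
    · rintro ⟨x, hx, rfl⟩
      obtain ⟨h1, -, h2, -⟩ := (mem_Adm I).1 hx
      exact ⟨h2.ne_empty, h1⟩
    · rintro ⟨h1, h2⟩
      obtain ⟨i, hi⟩ := exists_mem_Adm I h2 (Finset.nonempty_iff_ne_empty.2 h1)
      exact ⟨_, hi, rfl⟩
  have h2 := congrArg Finset.card h1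
  rw [Finset.card_image_of_injOn (Adm_snd_injOn I), Finset.card_erase_of_mem (by simp),
    Finset.card_powerset, Finset.card_range] at h2
  have : 0 < 2 ^ n := by positivity
  omega

theorem blkIdx_lt {m i : ℕ} (hi : i < I.length) (hm : m = I.sizeUpTo (i + 1)) {s j : ℕ}
    (hs : s < m) (hj : m ≤ j) : blkIdx n I s < blkIdx n I j := by
  subst hm
  refine Finset.card_lt_card (Finset.ssubset_iff_of_subset ?_ |>.2 ⟨i, ?_, ?_⟩)
  · intro a ha
    rw [Finset.mem_filter] at ha ⊢
    exact ⟨ha.1, by omega⟩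
  · simp [hi, hj]
  · simp [hs]

end Combinatorics

section Divisibility

variable {F : Type} [Field F] {n : ℕ}

/-- The linear form `c_1 x_1 + ⋯ + c_a x_a + x_{a+1}`. -/
def linForm (a : ℕ) (c : Fin a → F) : SV F n :=
  (∑ k : Fin a, MvPolynomial.C (c k) * xV F n k) + xV F n a

/-- The unipotent matrix whose substitution maps `x_{a+1}` to `linForm a c`. -/
def linFormMat (a : Fin n) (c : Fin a → F) : Matrix (Fin n) (Fin n) F := fun i j =>
  if j = a then (if h : (i : ℕ) < a then c ⟨i, h⟩ else if i = a then 1 else 0)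
  else if i = j then 1 else 0

theorem linFormMat_eq_zero {a : Fin n} {c : Fin a → F} {i j : Fin n} (h : j < i) :
    linFormMat a c i j = 0 := by
  unfold linFormMat
  split_ifs with h1 h2 h3 h3
  · subst h1
    exact absurd h2 h.le.not_gt
  · subst h1
    exact absurd h3 h.ne'
  · rfl
  · exact absurd h3 h.ne'
  · rfl

theorem det_linFormMat (a : Fin n) (c : Fin a → F) : (linFormMat a c).det = 1 := by
  have hT : (linFormMat a c).IsUpperTriangular := fun i j h => linFormMat_eq_zero h
  rw [Matrix.det_of_isUpperTriangular hT]
  refine Finset.prod_eq_one fun i _ => ?_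
  unfold linFormMat
  by_cases h : i = a
  · subst h
    simp
  · simp [h]

theorem gAct_linFormMat (a : Fin n) (c : Fin a → F) :
    gAct F n (linFormMat a c) (xV F n a) = linForm a c := by
  rw [gAct_xV, linForm]
  have h1 : ∑ j : Fin n, linFormMat a c j a • xV F n j = ∑ j ∈ range n,
      (if h : j < a then c ⟨j, h⟩ else if j = a then 1 else 0 : F) • xV F n j := by
    rw [Finset.sum_range]
    refine Finset.sum_congr rfl fun j _ => ?_
    simp only [linFormMat, if_true, Fin.ext_iff]
  have h2 : range (a + 1) ⊆ range n := Finset.range_subset_range.2 a.2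
  rw [h1, ← Finset.sum_subset h2, Finset.sum_range_succ, Finset.sum_range]
  · simp [MvPolynomial.smul_eq_C_mul]
  · intro j _ hj
    have hj' : ¬ j < a + 1 := fun h => hj (Finset.mem_range.2 h)
    rw [dif_neg (by omega), if_neg (by omega), zero_smul]

theorem xV_fin (a : Fin n) : xV F n a = X a := by
  rw [xV, dif_pos a.2]

theorem irreducible_linForm (a : Fin n) (c : Fin a → F) : Irreducible (linForm a c : SV F n) := by
  have hu : IsUnit (linFormMat a c).det := by rw [det_linFormMat]; exact isUnit_one
  let e : SV F n ≃ₐ[F] SV F n := AlgEquiv.ofAlgHom (gAct F n (linFormMat a c))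
    (gAct F n (linFormMat a c)⁻¹)
    (AlgHom.ext fun f => by
      rw [AlgHom.comp_apply, ← gAct_mul, Matrix.mul_nonsing_inv _ hu, gAct_one]; rfl)
    (AlgHom.ext fun f => by
      rw [AlgHom.comp_apply, ← gAct_mul, Matrix.nonsing_inv_mul _ hu, gAct_one]; rfl)
  have h : e (X a) = linForm a c := by rw [← gAct_linFormMat, xV_fin]; rfl
  rw [← h]
  exact ((MulEquiv.prime_iff e).2 (MvPolynomial.X_prime)).irreducible

theorem eval_linForm (v : Fin n → F) (a : Fin n) (c : Fin a → F) :
    eval v (linForm a c) = (∑ k : Fin a, c k * v ⟨k, k.2.trans a.2⟩) + v a := by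
  have h (k : Fin a) : xV F n k = X ⟨k, k.2.trans a.2⟩ := xV_fin ⟨k, k.2.trans a.2⟩
  simp [linForm, h, xV_fin]

theorem isRelPrime_linForm_of_lt {a b : Fin n} (h : a < b) (c : Fin a → F) (d : Fin b → F) :
    IsRelPrime (linForm a c : SV F n) (linForm b d) := by
  rw [(irreducible_linForm a c).isRelPrime_iff_not_dvd]
  rintro ⟨f, hf⟩
  have := congrArg (eval (Pi.single b (1 : F))) hf
  rw [map_mul, eval_linForm, eval_linForm, Finset.sum_eq_zero, Finset.sum_eq_zero,
    Pi.single_eq_same, Pi.single_eq_of_ne h.ne, zero_add, zero_add, zero_mul] at this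
  · exact one_ne_zero this
  · intro k _
    rw [Pi.single_eq_of_ne, mul_zero]
    intro h'
    have := congrArg Fin.val h'
    have h3 : (a : ℕ) < b := h
    simp only at this
    omega
  · intro k _
    rw [Pi.single_eq_of_ne, mul_zero]
    intro h'
    have := congrArg Fin.val h'
    simp only at this
    omega

theorem isRelPrime_linForm_of_ne (a : Fin n) {c d : Fin a → F} (h : c ≠ d) :
    IsRelPrime (linForm a c : SV F n) (linForm a d) := by
  rw [(irreducible_linForm a c).isRelPrime_iff_not_dvd]
  rintro ⟨f, hf⟩
  obtain ⟨k, hk⟩ := Function.ne_iff.1 h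
  have hka : (⟨k, k.2.trans a.2⟩ : Fin n) ≠ a := fun h' => by
    have := congrArg Fin.val h'
    simp only at this
    omega
  let v : Fin n → F := Pi.single ⟨k, k.2.trans a.2⟩ 1 - Pi.single a (c k)
  have key (e : Fin a → F) : eval v (linForm a e) = e k - c k := by
    rw [eval_linForm, Finset.sum_eq_single k]
    · simp [v, hka, hka.symm, sub_eq_add_neg]
    · intro k' _ hk'
      have h1 : (⟨k', k'.2.trans a.2⟩ : Fin n) ≠ ⟨k, k.2.trans a.2⟩ := fun h' =>
        hk' (Fin.ext (Fin.mk.inj_iff.1 h'))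
      have h2 : (⟨k', k'.2.trans a.2⟩ : Fin n) ≠ a := fun h' => by
        have := congrArg Fin.val h'
        simp only at this
        omega
      simp [v, h1, h2]
    · simp
  have := congrArg (eval v) hf
  rw [map_mul, key, key, sub_self, zero_mul, sub_eq_zero] at this
  exact hk this.symm

theorem Lm_pow_dvd [Fintype F] {e : ℕ} {h : SV F n}
    (hd : ∀ (a : Fin n) (c : Fin a → F), linForm a c ^ e ∣ h) : Lm F n n ^ e ∣ h := by
  rw [Lm, Finset.prod_range, ← Finset.prod_pow]
  have hlin (a : Fin n) : linProd F n a a = ∏ c : Fin a → F, linForm a c := rfl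
  refine Finset.prod_dvd_of_isRelPrime (fun a _ b _ hab => ?_) fun a _ => ?_
  · refine IsRelPrime.pow ?_
    rw [hlin, hlin]
    refine IsRelPrime.prod_left fun c _ => IsRelPrime.prod_right fun d _ => ?_
    rcases lt_or_gt_of_ne hab with h | h
    · exact isRelPrime_linForm_of_lt h c d
    · exact (isRelPrime_linForm_of_lt h d c).symm
  · rw [hlin, ← Finset.prod_pow]
    exact Finset.prod_dvd_of_isRelPrime
      (fun c _ d _ hcd => IsRelPrime.pow (isRelPrime_linForm_of_ne a hcd)) fun c _ => hd a c

theorem coeff_gAct_diagonal (d : Fin n → F) (h : SV F n) (m : Fin n →₀ ℕ) :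
    coeff m (gAct F n (Matrix.diagonal d) h) = (∏ i, d i ^ m i) * coeff m h := by
  induction h using MvPolynomial.induction_on' with
  | monomial u b =>
    have h1 : gAct F n (Matrix.diagonal d) (monomial u b) = C (∏ i, d i ^ u i) * monomial u b := by
      have hX (j : Fin n) : ∑ i, C (Matrix.diagonal d i j) * (X i : SV F n) = C (d j) * X j := by
        rw [Finset.sum_eq_single j]
        · rw [Matrix.diagonal_apply_eq]
        · intro i _ hij
          rw [Matrix.diagonal_apply_ne _ hij, C_0, zero_mul]
        · simp
      simp only [gAct, hX]
      rw [aeval_monomial, Finsupp.prod_fintype _ _ (by simp), monomial_eq,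
        Finsupp.prod_fintype _ _ (by simp)]
      simp only [mul_pow, Finset.prod_mul_distrib, map_prod, map_pow, MvPolynomial.algebraMap_eq]
      ring
    rw [h1, coeff_C_mul, coeff_monomial]
    split_ifs with hu
    · rw [hu]
    · simp
  | add p q hp hq => rw [map_add, coeff_add, hp, hq, coeff_add, mul_add]

theorem X_pow_dvd_of_coeff {e : ℕ} {a : Fin n} {h : SV F n}
    (hc : ∀ m, coeff m h ≠ 0 → e ≤ m a) : X a ^ e ∣ h := by
  rw [h.as_sum]
  refine Finset.dvd_sum fun m hm => ?_
  rw [X_pow_eq_monomial, monomial_dvd_monomial]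
  exact ⟨Or.inr (Finsupp.single_le_iff.2 (hc m (mem_support_iff.1 hm))), one_dvd _⟩

theorem blkIdx_mono (I : Composition n) : Monotone (blkIdx n I) := fun a b h =>
  Finset.card_le_card fun i hi => by
    rw [Finset.mem_filter] at hi ⊢
    exact ⟨hi.1, hi.2.trans h⟩

theorem mem_PIset_of_upper (I : Composition n) {g : Matrix (Fin n) (Fin n) F} (hg : IsUnit g.det)
    (h : ∀ a b : Fin n, b < a → g a b = 0) : g ∈ PIset F n I :=
  ⟨hg, fun a b hab => h a b ((blkIdx_mono I).reflect_lt hab)⟩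

theorem PIset_apply_eq_zero (I : Composition n) {g : Matrix (Fin n) (Fin n) F}
    (hg : g ∈ PIset F n I)
    (i : Fin I.length) (a b : Fin n) (hb : (b : ℕ) < I.sizeUpTo (i + 1))
    (ha : I.sizeUpTo (i + 1) ≤ a) : g a b = 0 :=
  hg.2 a b (blkIdx_lt I i.2 rfl hb ha)

theorem mul_tmul_one (e : SL F n) (s : SV F n) : e * (s ⊗ₜ[F] 1) = s • e := by
  rw [tmul_one_eq_smul, mul_smul_comm, mul_one]

variable [Fintype F]

theorem Lm_pow_dvd_of_semiinvariant (I : Composition n) {k : ℕ}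
    (hk1 : 1 ≤ k) {h : SV F n}
    (hh : ∀ g ∈ PIset F n I, g.det ^ k • gAct F n g h = h) :
    Lm F n n ^ (Fintype.card F - 1 - k) ∣ h := by
  refine Lm_pow_dvd fun a c => ?_
  have h1 : X a ^ (Fintype.card F - 1 - k) ∣ h := by
    refine X_pow_dvd_of_coeff fun m hm => ?_
    have h2 : Fintype.card F - 1 ∣ k + m a := by
      rw [← FiniteField.forall_pow_eq_one_iff]
      intro u
      have hdet : (Matrix.diagonal (Function.update 1 a (u : F))).det = u := by
        rw [Matrix.det_diagonal, Finset.prod_update_of_mem (Finset.mem_univ _)]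
        simp
      have h3 := congrArg (coeff m) (hh (Matrix.diagonal (Function.update 1 a (u : F)))
        (mem_PIset_of_upper I (by rw [hdet]; exact u.isUnit)
          fun i j hij => Matrix.diagonal_apply_ne _ hij.ne'))
      have h4 : ∏ i, Function.update (1 : Fin n → F) a (u : F) i ^ m i = (u : F) ^ m a := by
        rw [Finset.prod_eq_single a]
        · rw [Function.update_self]
        · intro i _ hi
          rw [Function.update_of_ne hi, Pi.one_apply, one_pow]
        · simp
      rw [coeff_smul, coeff_gAct_diagonal, hdet, h4, smul_eq_mul, ← mul_assoc, ← pow_add] at h3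
      refine Units.ext ?_
      rw [Units.val_pow_eq_pow_val, Units.val_one]
      exact mul_right_cancel₀ hm (by rw [h3, one_mul])
    have := Nat.le_of_dvd (by omega) h2
    omega
  have h2 := map_dvd (gAct F n (linFormMat a c)) h1
  have h3 := hh (linFormMat a c) (mem_PIset_of_upper I
    (by rw [det_linFormMat]; exact isUnit_one) fun i j hij => linFormMat_eq_zero hij)
  rw [det_linFormMat, one_pow, one_smul] at h3
  rwa [map_pow, ← xV_fin, gAct_linFormMat, h3] at h2

theorem det_pow_mul_pow {g : Matrix (Fin n) (Fin n) F} (hg : IsUnit g.det) {k : ℕ}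
    (hk : k ≤ Fintype.card F - 1) : g.det ^ k * g.det ^ (Fintype.card F - 1 - k) = 1 := by
  rw [← pow_add, Nat.add_sub_cancel' hk, FiniteField.pow_card_sub_one_eq_one _ hg.ne_zero]

theorem exists_eq_Lm_pow_mul (I : Composition n) {k : ℕ}
    (hk1 : 1 ≤ k) (hk : k ≤ Fintype.card F - 1) {h : SV F n}
    (hh : ∀ g ∈ PIset F n I, g.det ^ k • gAct F n g h = h) :
    ∃ h' ∈ invS F n (PIset F n I), h = Lm F n n ^ (Fintype.card F - 1 - k) * h' := by
  obtain ⟨h', rfl⟩ := Lm_pow_dvd_of_semiinvariant I hk1 hh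
  refine ⟨h', fun g hg => ?_, rfl⟩
  have h1 := hh g hg
  rw [map_mul, map_pow, gAct_Lm, smul_pow, smul_mul_assoc, smul_smul,
    det_pow_mul_pow hg.1 hk, one_smul] at h1
  exact mul_left_cancel₀ (pow_ne_zero _ (Lm_ne_zero le_rfl)) h1

end Divisibility

section FreeBasis

variable {F : Type} [Field F] [Fintype F] {n : ℕ}

/-- A choice of reduction matrix, see `exists_reduction`. -/
def redT (F : Type) [Field F] [Fintype F] (n m : ℕ) : ℕ → ℕ → SV F n :=
  (exists_reduction F n m).choose

theorem redT_of_lt {m c b : ℕ} (hb : b < m) : redT F n m c b = if c = b then 1 else 0 :=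
  (exists_reduction F n m).choose_spec.1 c b hb

theorem redT_spec {m : ℕ} (b s : ℕ) (hs : s < m) :
    mooreA F n b s = ∑ c ∈ range m, redT F n m c b * mooreA F n c s :=
  (exists_reduction F n m).choose_spec.2 b s hs

variable (F) in
/-- The image under `phi` of Mui's element attached to `x`, up to a scalar factor. -/
def muiU (I : Composition n) (x : Fin I.length × Finset ℕ) : SL F n :=
  shuffleSign (SV F n) x.2 • sortedProd (wV (redT F n (I.sizeUpTo ((x.1 : ℕ) + 1)))) x.2

variable (I : Composition n)

theorem redT_mem_invS (i : Fin I.length) {c b : ℕ} (hc : c < I.sizeUpTo (i + 1)) :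
    redT F n (I.sizeUpTo (i + 1)) c b ∈ invS F n (PIset F n I) := fun _ hg =>
  gAct_reduction (I.sizeUpTo_le _) redT_spec hg.1 (PIset_apply_eq_zero I hg i) hc

theorem sigma_muiU {g : Matrix (Fin n) (Fin n) F} (hg : g ∈ PIset F n I)
    {x : Fin I.length × Finset ℕ} (hx : x ∈ Adm n I) : sigma g (muiU F I x) = muiU F I x := by
  rw [muiU, sigma_smul, sigma_wV (I.sizeUpTo_le _) redT_spec hg.1
    (PIset_apply_eq_zero I hg x.1) ((mem_Adm I).1 hx).2.1, shuffleSign, map_pow, map_neg, map_one]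

theorem wV_sub_mem_weightFil (i : Fin I.length) {c : ℕ} (hc : c < I.sizeUpTo (i + 1)) :
    wV (redT F n (I.sizeUpTo (i + 1))) c - yT F n c ∈
      weightFil (invS F n (PIset F n I)) (yT F n) (c + 1) := by
  have hcn : c ∈ range n := Finset.mem_range.2 (hc.trans_le (I.sizeUpTo_le _))
  have h1 : yT F n c = ∑ b ∈ range n, (if c = b then 1 else 0 : SV F n) • yT F n b := by
    simp only [ite_smul, one_smul, zero_smul, Finset.sum_ite_eq, hcn, if_true]
  rw [h1, wV, comb, ← Finset.sum_sub_distrib]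
  refine Submodule.sum_mem _ fun b _ => ?_
  by_cases hb : b < I.sizeUpTo (i + 1)
  · rw [redT_of_lt hb, sub_self]
    exact Submodule.zero_mem _
  · rw [if_neg (by omega), zero_smul, sub_zero]
    exact Submodule.smul_mem _ (⟨_, redT_mem_invS I i hc⟩ : invS F n (PIset F n I))
      (single_mem_weightFil _ (by omega))

variable (F) in
/-- The family consisting of `1` and the `muiU`. -/
def muiFamily : Option (Adm n I) → SL F n := fun o => o.elim 1 fun x => muiU F I x

theorem sortedProd_mem_span_muiFamily {B : Finset ℕ} (hB : B ⊆ range n) :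
    sortedProd (yT F n) B ∈
      Submodule.span (invS F n (PIset F n I)) (Set.range (muiFamily F I)) := by
  refine (anticomm_yT F n).sortedProd_mem_of_triangular (fun b hb => ?_) _ (fun B hB => ?_) hB
  · rw [yT, yV, dif_neg (by omega), TensorProduct.tmul_zero]
  · rcases B.eq_empty_or_nonempty with rfl | hne
    · refine ⟨1, Submodule.subset_span ⟨none, rfl⟩, ?_⟩
      rw [sortedProd_empty, sub_self]
      exact Submodule.zero_mem _
    · obtain ⟨i, hi⟩ := exists_mem_Adm I hB hne
      refine ⟨sortedProd (wV (redT F n (I.sizeUpTo ((i : ℕ) + 1)))) B, ?_,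
        sortedProd_sub_mem_weightFil fun c hc =>
          wV_sub_mem_weightFil I i (Finset.mem_range.1 (((mem_Adm I).1 hi).2.1 hc))⟩
      have h1 : muiU F I (i, B) ∈
          Submodule.span (invS F n (PIset F n I)) (Set.range (muiFamily F I)) :=
        Submodule.subset_span ⟨some ⟨_, hi⟩, rfl⟩
      have h2 : sortedProd (wV (redT F n (I.sizeUpTo ((i : ℕ) + 1)))) B =
          shuffleSign (invS F n (PIset F n I)) B • muiU F I (i, B) := by
        have h3 : ((shuffleSign (invS F n (PIset F n I)) B : invS F n (PIset F n I)) :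
            SV F n) = shuffleSign (SV F n) B := by
          simp [shuffleSign]
        rw [Subalgebra.smul_def, h3, muiU, smul_smul, shuffleSign_mul_self, one_smul]
      rw [h2]
      exact Submodule.smul_mem _ _ h1

theorem slBasis_mem_span_muiFamily (T : Finset (Fin n)) :
    slBasis F n T ∈ Submodule.span (invS F n (PIset F n I)) (Set.range (muiFamily F I)) := by
  rw [slBasis_apply]
  exact sortedProd_mem_span_muiFamily I (map_val_subset T)

theorem sum_muiFamily {K : Type*} [CommRing K] [Module K (SL F n)] (c : Option (Adm n I) → K) :
    ∑ o, c o • muiFamily F I o = c none • 1 + ∑ x : Adm n I, c (some x) • muiU F I x := by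
  rw [Fintype.sum_option]
  rfl

theorem linearIndependent_muiFamily : LinearIndependent (SV F n) (muiFamily F I) := by
  have hcard : Fintype.card (Finset (Fin n)) = Fintype.card (Option (Adm n I)) := by
    rw [Fintype.card_finset, Fintype.card_fin, Fintype.card_option, Fintype.card_coe,
      ← one_add_card_Adm I, add_comm]
  let e : Finset (Fin n) ≃ Option (Adm n I) := Fintype.equivOfCardEq hcard
  let f : SL F n →ₗ[SV F n] SL F n := (slBasis F n).constr ℕ fun T => muiFamily F I (e T)
  have hf (T : Finset (Fin n)) : f (slBasis F n T) = muiFamily F I (e T) :=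
    (slBasis F n).constr_basis ℕ _ T
  have hsurj : Function.Surjective f := by
    rw [← LinearMap.range_eq_top, eq_top_iff, ← (slBasis F n).span_eq, Submodule.span_le]
    rintro _ ⟨T, rfl⟩
    obtain ⟨c, hc⟩ := (Submodule.mem_span_range_iff_exists_fun _).1
      (slBasis_mem_span_muiFamily (F := F) I T)
    rw [← hc]
    refine Submodule.sum_mem _ fun o _ => ?_
    rw [Subalgebra.smul_def]
    refine Submodule.smul_mem _ _ ⟨slBasis F n (e.symm o), ?_⟩
    rw [hf, e.apply_symm_apply]
  have : Module.Finite (SV F n) (SL F n) := Module.Finite.of_basis (slBasis F n)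
  have hinj : Function.Injective f := OrzechProperty.injective_of_surjective_endomorphism f hsurj
  have h1 := (slBasis F n).linearIndependent.map' f (LinearMap.ker_eq_bot.2 hinj)
  have h2 : f ∘ slBasis F n = muiFamily F I ∘ e := funext hf
  rw [h2] at h1
  exact (linearIndependent_equiv e).1 h1

/-- The combination of the candidate basis elements with the given coefficients. -/
def muiComb (F : Type) [Field F] [Fintype F] (k : ℕ) (I : Composition n) (c₀ : SV F n)
    (c : Fin I.length × Finset ℕ → SV F n) : SL F n :=
  (c₀ * (∏ i : Fin I.length, theta F n I i) ^ (Fintype.card F - 1 - k)) ⊗ₜ[F] 1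
    + ∑ x ∈ Adm n I, (c x ⊗ₜ[F] 1) *
      (MuiM F (Fintype.card F) n (I.sizeUpTo ((x.1 : ℕ) + 1)) x.2 *
        ((∏ i' : Fin I.length,
          theta F n I i' ^ (if i' ≤ x.1 then Fintype.card F - 2 - k
            else Fintype.card F - 1 - k)) ⊗ₜ[F] 1))

theorem phi_muiComb {k : ℕ} (hk : 1 ≤ k) (hk2 : k ≤ Fintype.card F - 2) (c₀ : SV F n)
    (c : Fin I.length × Finset ℕ → SV F n) :
    phi F n (muiComb F k I c₀ c) = Lm F n n ^ (Fintype.card F - 1 - k) •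
      (c₀ • (1 : SL F n) + ∑ x ∈ Adm n I, c x • muiU F I x) := by
  have he : Fintype.card F - 1 - k = Fintype.card F - 2 - k + 1 := by omega
  rw [muiComb, map_add, map_sum, smul_add, Finset.smul_sum, tmul_one_eq_smul, map_smul, map_one,
    prod_theta, mul_comm, mul_smul]
  congr 1
  refine Finset.sum_congr rfl fun x hx => ?_
  rw [tmul_one_mul, mul_tmul_one, map_smul, map_smul, phi_MuiM (I.sizeUpTo_le _) redT_spec
    ((mem_Adm I).1 hx).2.1, muiU, he, ← prod_theta_pow I x.1 (Fintype.card F - 2 - k)]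
  simp only [smul_smul]
  congr 1
  ring

theorem phi_algebraMap_smul (a : F) (f : SL F n) : phi F n (a • f) = a • phi F n f := by
  rw [← algebraMap_smul (SV F n) a f, map_smul, algebraMap_smul]

theorem phi_inj : Function.Injective (phi F n) :=
  phi_injective (by rw [minorDet_mooreA]; exact Lm_ne_zero le_rfl)

theorem muiComb_mem {k : ℕ} (hk : 1 ≤ k) (hk2 : k ≤ Fintype.card F - 2) {c₀ : SV F n}
    {c : Fin I.length × Finset ℕ → SV F n} (hc₀ : c₀ ∈ invS F n (PIset F n I))
    (hc : ∀ x ∈ Adm n I, c x ∈ invS F n (PIset F n I)) :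
    muiComb F k I c₀ c ∈ invSLtw F n k (PIset F n I) := by
  intro g hg
  apply phi_inj
  have hu : sigma g (c₀ • (1 : SL F n) + ∑ x ∈ Adm n I, c x • muiU F I x) =
      c₀ • (1 : SL F n) + ∑ x ∈ Adm n I, c x • muiU F I x := by
    rw [map_add, map_sum, sigma_smul, map_one, hc₀ g hg]
    congr 1
    refine Finset.sum_congr rfl fun x hx => ?_
    rw [sigma_smul, hc x hx g hg, sigma_muiU I hg hx]
  rw [phi_algebraMap_smul, phi_tAct, phi_muiComb I hk hk2, sigma_smul, hu, map_pow, gAct_Lm,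
    smul_pow, smul_assoc, smul_smul, det_pow_mul_pow hg.1 (by omega), one_smul]

theorem exists_eq_muiComb {k : ℕ} (hk : 1 ≤ k) (hk2 : k ≤ Fintype.card F - 2) {f : SL F n}
    (hf : f ∈ invSLtw F n k (PIset F n I)) :
    ∃ c₀ : SV F n, ∃ c : Fin I.length × Finset ℕ → SV F n, c₀ ∈ invS F n (PIset F n I) ∧
      (∀ x ∈ Adm n I, c x ∈ invS F n (PIset F n I)) ∧ f = muiComb F k I c₀ c := by
  have h1 (T : Finset (Fin n)) (g) (hg : g ∈ PIset F n I) :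
      g.det ^ k • gAct F n g ((slBasis F n).repr (phi F n f) T) =
        (slBasis F n).repr (phi F n f) T := by
    have h2 := congrArg (phi F n) (hf g hg)
    have h3 : sigma g (phi F n f) =
        ∑ T, gAct F n g ((slBasis F n).repr (phi F n f) T) • slBasis F n T := by
      conv_lhs => rw [← (slBasis F n).sum_repr (phi F n f)]
      rw [map_sum]
      refine Finset.sum_congr rfl fun T _ => ?_
      rw [sigma_smul, slBasis_apply, sortedProd_map]
      congr 1
      exact sortedProd_congr fun c _ => sigma_yT g c
    rw [phi_algebraMap_smul, phi_tAct, h3, Finset.smul_sum] at h2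
    simp only [← smul_assoc] at h2
    have h4 := DFunLike.congr_fun (congrArg (slBasis F n).repr h2) T
    rwa [(slBasis F n).repr_sum_self] at h4
  choose h hh hh' using fun T => exists_eq_Lm_pow_mul I hk (by omega) (h1 T)
  have h2 : phi F n f =
      Lm F n n ^ (Fintype.card F - 1 - k) • ∑ T, h T • slBasis F n T := by
    conv_lhs => rw [← (slBasis F n).sum_repr (phi F n f)]
    rw [Finset.smul_sum]
    refine Finset.sum_congr rfl fun T _ => ?_
    rw [smul_smul, ← hh']
  have h3 : ∑ T, h T • slBasis F n T ∈
      Submodule.span (invS F n (PIset F n I)) (Set.range (muiFamily F I)) :=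
    Submodule.sum_mem _ fun T _ => Submodule.smul_mem _
      (⟨h T, hh T⟩ : invS F n (PIset F n I)) (slBasis_mem_span_muiFamily I T)
  obtain ⟨d, hd⟩ := (Submodule.mem_span_range_iff_exists_fun _).1 h3
  rw [sum_muiFamily] at hd
  obtain ⟨c, hc⟩ : ∃ c : Fin I.length × Finset ℕ → SV F n,
      ∀ x : Adm n I, c x = d (some x) := by
    classical
    refine ⟨fun x => if hx : x ∈ Adm n I then d (some ⟨x, hx⟩) else 0, fun x => ?_⟩
    exact dif_pos x.2
  refine ⟨d none, c, (d none).2, fun x hx => ?_, phi_inj ?_⟩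
  · rw [hc ⟨x, hx⟩]
    exact (d (some ⟨x, hx⟩)).2
  · have h4 : ∑ x ∈ Adm n I, c x • muiU F I x = ∑ x : Adm n I, d (some x) • muiU F I x := by
      rw [← Finset.sum_coe_sort (Adm n I)]
      exact Finset.sum_congr rfl fun x _ => by rw [hc, Subalgebra.smul_def]
    rw [phi_muiComb I hk hk2, h2, ← hd, h4, Subalgebra.smul_def]

theorem eq_zero_of_muiComb_eq_zero {k : ℕ} (hk : 1 ≤ k) (hk2 : k ≤ Fintype.card F - 2)
    {c₀ : SV F n} {c : Fin I.length × Finset ℕ → SV F n} (h : muiComb F k I c₀ c = 0) :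
    c₀ = 0 ∧ ∀ x ∈ Adm n I, c x = 0 := by
  have h1 := congrArg (phi F n) h
  rw [phi_muiComb I hk hk2, map_zero] at h1
  have h2 := sl_smul_eq_zero (pow_ne_zero _ (Lm_ne_zero le_rfl)) h1
  let d : Option (Adm n I) → SV F n := fun o => o.elim c₀ fun x => c x
  have h3 : ∑ o, d o • muiFamily F I o = 0 := by
    rw [sum_muiFamily, ← h2, ← Finset.sum_coe_sort (Adm n I)]
    rfl
  have h4 := Fintype.linearIndependent_iff.1 (linearIndependent_muiFamily I) d h3
  exact ⟨h4 none, fun x hx => h4 (some ⟨x, hx⟩)⟩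

end FreeBasis

/-- **Theorem 3.1(2)** (Wan–Wang). For `1 ≤ k ≤ q−2`,
`(S(V) ⊗ Λ(V) ⊗ Det^k)^{P_I}` is a free `S(V)^{P_I}`-module of rank `2^n`, with
basis `(θ_1⋯θ_ℓ)^{q−1−k}` together with the elements
`M_{m_i;b_1,…,b_j} θ_1^{q−2−k} ⋯ θ_i^{q−2−k} θ_{i+1}^{q−1−k} ⋯ θ_ℓ^{q−1−k}`. -/
theorem parabolic_twisted_invariants_free_basis
    (F : Type) [Field F] [Fintype F] (p r q n k : ℕ)
    (hp : p.Prime) (hr : 0 < r) (hq : q = p ^ r) (hF : Fintype.card F = q)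
    (hk1 : 1 ≤ k) (hk2 : k ≤ q - 2)
    (I : Composition n) :
    (1 + (Adm n I).card = 2 ^ n)
    ∧ (∀ f : SL F n, f ∈ invSLtw F n k (PIset F n I) ↔
        ∃ c₀ : SV F n, ∃ c : Fin I.length × Finset ℕ → SV F n,
          c₀ ∈ invS F n (PIset F n I) ∧
          (∀ x ∈ Adm n I, c x ∈ invS F n (PIset F n I)) ∧
          f = (c₀ * (∏ i : Fin I.length, theta F n I i) ^ (q - 1 - k)) ⊗ₜ[F] 1
            + ∑ x ∈ Adm n I, (c x ⊗ₜ[F] 1) *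
              (MuiM F q n (I.sizeUpTo ((x.1 : ℕ) + 1)) x.2 *
                ((∏ i' : Fin I.length,
                  theta F n I i' ^ (if i' ≤ x.1 then q - 2 - k else q - 1 - k)) ⊗ₜ[F] 1)))
    ∧ (∀ c₀ : SV F n, ∀ c : Fin I.length × Finset ℕ → SV F n,
        c₀ ∈ invS F n (PIset F n I) →
        (∀ x ∈ Adm n I, c x ∈ invS F n (PIset F n I)) →
        (c₀ * (∏ i : Fin I.length, theta F n I i) ^ (q - 1 - k)) ⊗ₜ[F] 1
          + ∑ x ∈ Adm n I, (c x ⊗ₜ[F] 1) *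
            (MuiM F q n (I.sizeUpTo ((x.1 : ℕ) + 1)) x.2 *
              ((∏ i' : Fin I.length,
                theta F n I i' ^ (if i' ≤ x.1 then q - 2 - k else q - 1 - k)) ⊗ₜ[F] 1)) = 0 →
        c₀ = 0 ∧ ∀ x ∈ Adm n I, c x = 0) := by
  subst hF
  refine ⟨one_add_card_Adm I, fun f => ⟨fun hf => exists_eq_muiComb I hk1 hk2 hf, ?_⟩,
    fun c₀ c _ _ h => eq_zero_of_muiComb_eq_zero I hk1 hk2 h⟩
  rintro ⟨c₀, c, hc₀, hc, rfl⟩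
  exact muiComb_mem I hk1 hk2 hc₀ hc
end
end

section
/- For every integer q ≥ 2 (not necessarily a prime power), the following identity holds in the field of rational functions ℚ(t,s): X(t,s;q) = t^{−n} (s t^{q^n−1} + t^{q^{n−1}}) ∏_{i=0}^{n−2}(s + t^{q^i}) / ∏_{i=1}^{n}(1 − t^{q^i−1}). -/
open MvPolynomial Finset

noncomputable section

namespace CompositionIdentity

/-- Splitting a sum over the compositions of `n` according to the last block. -/
lemma sum_composition_eq_sum_append {M : Type*} [AddCommMonoid M] {n : ℕ} (hn : 0 < n)
    (f : List ℕ → M) :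
    ∑ I : Composition n, f I.blocks =
      ∑ a ∈ range n, ∑ J : Composition a, f (J.blocks ++ [n - a]) := by
  rw [Finset.sum_sigma']
  symm
  refine Finset.sum_bij
    (fun p hp => (⟨p.2.blocks ++ [n - p.1], fun {i} hi => ?_, ?_⟩ : Composition n))
    (fun _ _ => mem_univ _) ?_ ?_ (fun _ _ => rfl)
  · have := mem_range.1 (mem_sigma.1 hp).1
    rcases List.mem_append.1 hi with h | h
    · exact p.2.blocks_pos h
    · rw [List.mem_singleton.1 h]
      omega
  · have := mem_range.1 (mem_sigma.1 hp).1
    rw [List.sum_append, p.2.blocks_sum, List.sum_singleton]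
    omega
  · rintro ⟨a, J⟩ _ ⟨b, J'⟩ _ h
    have hbl : J.blocks = J'.blocks := (List.append_inj' (congrArg Composition.blocks h) rfl).1
    obtain rfl : a = b := by rw [← J.blocks_sum, ← J'.blocks_sum, hbl]
    rw [Composition.ext hbl]
  · intro I _
    have hne : I.blocks ≠ [] := by
      intro h
      have := I.blocks_sum
      simp [h] at this
      omega
    have happ := List.dropLast_append_getLast hne
    have hsum : I.blocks.dropLast.sum + I.blocks.getLast hne = n := by
      have := congrArg List.sum happ
      rwa [List.sum_append, List.sum_singleton, I.blocks_sum] at this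
    have hpos : 0 < I.blocks.getLast hne := I.blocks_pos (List.getLast_mem hne)
    refine ⟨⟨I.blocks.dropLast.sum,
      ⟨I.blocks.dropLast, fun {i} hi => I.blocks_pos (List.dropLast_subset _ hi), rfl⟩⟩, ?_, ?_⟩
    · simp only [mem_sigma, mem_range, mem_univ, and_true]
      omega
    · refine Composition.ext ?_
      change I.blocks.dropLast ++ [n - I.blocks.dropLast.sum] = I.blocks
      rw [show n - I.blocks.dropLast.sum = I.blocks.getLast hne by omega, happ]

variable {K : Type*} [Field K]

/-- The weight of a block ending at `b` and of size `k`. -/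
def blockWeight (x : ℕ → K) (b k : ℕ) : K := ∏ j ∈ Icc 1 k, (1 - x b / x (b - j))

/-- The signed inverse product of block weights of a list of block sizes. -/
def listWeight (x : ℕ → K) (L : List ℕ) : K :=
  (-1) ^ (L.sum - L.length) /
    ∏ i ∈ range L.length, blockWeight x (L.take (i + 1)).sum (L.getD i 0)

/-- The numerator attached to a list of block sizes. -/
def listNumerator (T P : ℕ → K) (L : List ℕ) : K :=
  1 - T (L.take 1).sum
    + ∑ i ∈ Icc 1 (L.length - 1), (T (L.take i).sum - T (L.take (i + 1)).sum) * P (L.take i).sum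
    + T L.sum * P L.sum

lemma listWeight_append (x : ℕ → K) {L : List ℕ} {k : ℕ} (hL : L.length ≤ L.sum) (hk : 0 < k) :
    listWeight x (L ++ [k]) =
      listWeight x L * ((-1) ^ (k - 1) / blockWeight x (L.sum + k) k) := by
  have hprod : ∏ i ∈ range L.length,
      blockWeight x ((L ++ [k]).take (i + 1)).sum ((L ++ [k]).getD i 0) =
      ∏ i ∈ range L.length, blockWeight x (L.take (i + 1)).sum (L.getD i 0) := by
    refine prod_congr rfl fun i hi => ?_
    have hi := mem_range.1 hi
    rw [List.take_append_of_le_length (by omega), List.getD_append _ _ _ _ hi]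
  rw [listWeight, listWeight, List.length_append, List.length_singleton, prod_range_succ, hprod,
    List.take_of_length_le (by simp), List.getD_append_right _ _ _ _ le_rfl, List.sum_append,
    List.sum_singleton, show L.sum + k - (L.length + 1) = (L.sum - L.length) + (k - 1) by omega,
    pow_add, div_mul_div_comm]
  simp

lemma listNumerator_append {T P : ℕ → K} (hT : T 0 = 1) (hP : P 0 = 1) (L : List ℕ) (k : ℕ) :
    listNumerator T P (L ++ [k]) =
      listNumerator T P L - T (L.sum + k) * P L.sum + T (L.sum + k) * P (L.sum + k) := by
  rcases L.eq_nil_or_concat with rfl | ⟨L', b, rfl⟩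
  · simp [listNumerator, hT, hP]
  · rw [List.concat_eq_append]
    set L := L' ++ [b] with hLdef
    have hlen : L.length = L'.length + 1 := by simp [hLdef]
    have hsum : ∀ i ∈ Icc 1 L'.length,
        (T ((L ++ [k]).take i).sum - T ((L ++ [k]).take (i + 1)).sum) *
            P ((L ++ [k]).take i).sum =
          (T (L.take i).sum - T (L.take (i + 1)).sum) * P (L.take i).sum := by
      intro i hi
      have := (mem_Icc.1 hi).2
      rw [List.take_append_of_le_length (i := i) (by omega),
        List.take_append_of_le_length (i := i + 1) (by omega)]
    have hLk : (L ++ [k]).sum = L.sum + k := by rw [List.sum_append, List.sum_singleton]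
    rw [listNumerator, listNumerator, List.length_append, List.length_singleton,
      List.take_append_of_le_length (i := 1) (by omega), hlen, Nat.add_sub_cancel, Nat.add_sub_cancel,
      sum_Icc_succ_top (by omega), sum_congr rfl hsum,
      List.take_append_of_le_length (i := L'.length + 1) (by omega),
      List.take_of_length_le (i := L'.length + 1) (l := L) (by omega),
      List.take_of_length_le (i := L'.length + 1 + 1) (by simp [hlen]), hLk]
    ring

/-- The signed inverse weight of the block `(a, n]`, with the convention `-1` for `a = n`. -/
def stepWeight (x : ℕ → K) (a n : ℕ) : K := -∏ k ∈ Ico a n, -(x k / (x k - x n))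

lemma stepWeight_self (x : ℕ → K) (n : ℕ) : stepWeight x n n = -1 := by simp [stepWeight]

lemma stepWeight_mul_sub {x : ℕ → K} (hx : Function.Injective x) {a n : ℕ} (h : a < n) :
    stepWeight x a n * (x a - x n) = -(x a * stepWeight x (a + 1) n) := by
  have hne : x a - x n ≠ 0 := sub_ne_zero.2 (hx.ne h.ne)
  rw [stepWeight, stepWeight, prod_eq_prod_Ico_succ_bot h]
  field_simp

lemma sign_div_blockWeight {x : ℕ → K} (hx0 : ∀ i, x i ≠ 0) {a n : ℕ} (h : a < n) :
    (-1) ^ (n - a - 1) / blockWeight x n (n - a) = stepWeight x a n := by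
  have hb : blockWeight x n (n - a) = ∏ k ∈ Ico a n, (1 - x n / x k) := by
    refine prod_bij' (fun j _ => n - j) (fun k _ => n - k) ?_ ?_ ?_ ?_ ?_ <;>
      simp only [mem_Icc, mem_Ico] <;> intros <;> first | omega | rfl | trivial
  have hs : (-1 : K) ^ (n - a) = -(-1) ^ (n - a - 1) := by
    rw [← Nat.sub_add_cancel (show 1 ≤ n - a by omega), pow_succ]
    simp
  rw [hb, stepWeight, prod_neg, Nat.card_Ico, hs, neg_mul, neg_neg, div_eq_mul_inv,
    ← prod_inv_distrib]
  congr 1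
  refine prod_congr rfl fun k _ => ?_
  have := hx0 k
  rw [one_sub_div this, inv_div]

/-- Closed form of the sum of all weights, twisted by `s`. -/
def twistedTotal (x : ℕ → K) (s : K) (n : ℕ) : K :=
  ∏ i ∈ range n, ((x i + s) / (x 0 - x (i + 1)))

lemma twistedTotal_succ (x : ℕ → K) (s : K) (n : ℕ) :
    twistedTotal x s (n + 1) = twistedTotal x s n * ((x n + s) / (x 0 - x (n + 1))) :=
  prod_range_succ _ _

lemma sum_stepWeight_mul_total {x : ℕ → K} (hx : Function.Injective x) {n : ℕ} (hn : 0 < n) :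
    ∑ a ∈ range n, stepWeight x a n * twistedTotal x 0 a = twistedTotal x 0 n := by
  have h0 : ∀ {m}, 0 < m → x 0 - x m ≠ 0 := fun h => sub_ne_zero.2 (hx.ne h.ne)
  have key : ∀ m ≤ n, ∑ a ∈ range m, stepWeight x a n * twistedTotal x 0 a =
      -(stepWeight x m n * twistedTotal x 0 m * (x 0 - x m)) / (x 0 - x n) := by
    intro m
    induction m with
    | zero => simp
    | succ m ih =>
      intro hm
      have hstep := stepWeight_mul_sub hx (show m < n by omega)
      have h1 := h0 hn
      have h2 := h0 m.succ_pos
      rw [sum_range_succ, ih (by omega), twistedTotal_succ, add_zero]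
      field_simp
      linear_combination twistedTotal x 0 m * hstep
  rw [key n le_rfl, stepWeight_self]
  have := h0 hn
  field_simp

lemma sum_stepWeight_telescope {x : ℕ → K} (hx : Function.Injective x) (s : K) (n : ℕ) :
    ∑ a ∈ range (n + 1), stepWeight x a (n + 1) *
        ((if a = 0 then 0 else x (a - 1) * twistedTotal x s (a - 1)) +
          (x a - x (n + 1)) * twistedTotal x s a) = x n * twistedTotal x s n := by
  have key : ∀ m ≤ n, ∑ a ∈ range (m + 1), stepWeight x a (n + 1) *
        ((if a = 0 then 0 else x (a - 1) * twistedTotal x s (a - 1)) +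
          (x a - x (n + 1)) * twistedTotal x s a) =
        -(stepWeight x (m + 1) (n + 1) * (x m * twistedTotal x s m)) := by
    intro m
    induction m with
    | zero =>
      intro _
      have hstep := stepWeight_mul_sub hx n.succ_pos
      simp only [zero_add, sum_range_one, if_true]
      linear_combination twistedTotal x s 0 * hstep
    | succ m ih =>
      intro hm
      have hstep := stepWeight_mul_sub hx (show m + 1 < n + 1 by omega)
      rw [sum_range_succ, ih (by omega), if_neg m.succ_ne_zero, Nat.add_sub_cancel]
      linear_combination twistedTotal x s (m + 1) * hstep
  rw [key n le_rfl, stepWeight_self]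
  ring

lemma listWeight_append_sub {x : ℕ → K} (hx0 : ∀ i, x i ≠ 0) {a n : ℕ} (h : a < n)
    (J : Composition a) :
    listWeight x (J.blocks ++ [n - a]) = listWeight x J.blocks * stepWeight x a n := by
  have hl : J.blocks.length ≤ J.blocks.sum := J.blocks_sum.symm ▸ J.length_le
  rw [listWeight_append x hl (by omega), J.blocks_sum, Nat.add_sub_cancel' h.le,
    sign_div_blockWeight hx0 h]

lemma sum_listWeight {x : ℕ → K} (hx : Function.Injective x) (hx0 : ∀ i, x i ≠ 0) (n : ℕ) :
    ∑ I : Composition n, listWeight x I.blocks = twistedTotal x 0 n := by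
  induction n using Nat.strong_induction_on with
  | _ n ih =>
    rcases n.eq_zero_or_pos with rfl | hn
    · have : ∀ I : Composition 0, listWeight x I.blocks = 1 := fun I => by
        rw [I.blocks_eq_nil.2 rfl]
        simp [listWeight]
      simp [this, composition_card, twistedTotal]
    · rw [sum_composition_eq_sum_append hn (listWeight x), ← sum_stepWeight_mul_total hx hn]
      refine sum_congr rfl fun a ha => ?_
      have ha := mem_range.1 ha
      rw [← ih a ha, mul_sum]
      refine sum_congr rfl fun J _ => ?_
      rw [listWeight_append_sub hx0 ha, mul_comm]

lemma prod_mul_total {x : ℕ → K} (hx0 : ∀ i, x i ≠ 0) (s : K) (n : ℕ) :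
    (∏ j ∈ range n, (1 + s * (x j)⁻¹)) * twistedTotal x 0 n = twistedTotal x s n := by
  rw [twistedTotal, twistedTotal, ← prod_mul_distrib]
  refine prod_congr rfl fun j _ => ?_
  have := hx0 j
  rw [add_zero, ← mul_div_assoc]
  congr 1
  field_simp

lemma sum_listWeight_mul_listNumerator {x : ℕ → K} (hx : Function.Injective x)
    (hx0 : ∀ i, x i ≠ 0) (s : K) (n : ℕ) :
    ∑ I : Composition n, listWeight x I.blocks *
        listNumerator (fun m => x m / x 0) (fun m => ∏ j ∈ range m, (1 + s * (x j)⁻¹)) I.blocks =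
      ((if n = 0 then 0 else x (n - 1) * twistedTotal x s (n - 1)) +
        x n * twistedTotal x s n) / x 0 := by
  set T : ℕ → K := fun m => x m / x 0 with hTdef
  set P : ℕ → K := fun m => ∏ j ∈ range m, (1 + s * (x j)⁻¹) with hPdef
  have hT : T 0 = 1 := div_self (hx0 0)
  have hP : P 0 = 1 := by simp [hPdef]
  induction n using Nat.strong_induction_on with
  | _ n ih =>
    rcases n with _ | n
    · have : ∀ I : Composition 0, listWeight x I.blocks * listNumerator T P I.blocks = 1 :=
        fun I => by
          rw [I.blocks_eq_nil.2 rfl]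
          simp [listWeight, listNumerator, hT, hP]
      simp [this, composition_card, twistedTotal, hx0]
    · have hinner : ∀ a ∈ range (n + 1),
          ∑ J : Composition a, listWeight x (J.blocks ++ [n + 1 - a]) *
              listNumerator T P (J.blocks ++ [n + 1 - a]) =
            (stepWeight x a (n + 1) *
              ((if a = 0 then 0 else x (a - 1) * twistedTotal x s (a - 1)) +
                (x a - x (n + 1)) * twistedTotal x s a)) / x 0 +
            T (n + 1) * P (n + 1) * (stepWeight x a (n + 1) * twistedTotal x 0 a) := by
        intro a ha
        have ha := mem_range.1 ha
        have hterm : ∀ J : Composition a, listWeight x (J.blocks ++ [n + 1 - a]) *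
              listNumerator T P (J.blocks ++ [n + 1 - a]) =
            stepWeight x a (n + 1) * (listWeight x J.blocks * listNumerator T P J.blocks) +
            stepWeight x a (n + 1) * (T (n + 1) * P (n + 1) - T (n + 1) * P a) *
              listWeight x J.blocks := by
          intro J
          rw [listWeight_append_sub hx0 ha, listNumerator_append hT hP, J.blocks_sum,
            Nat.add_sub_cancel' ha.le]
          ring
        rw [sum_congr rfl fun J _ => hterm J, sum_add_distrib, ← mul_sum, ← mul_sum, ih a ha,
          sum_listWeight hx hx0, ← prod_mul_total hx0 s a]
        simp only [hTdef, hPdef]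
        ring
      rw [sum_composition_eq_sum_append n.succ_pos
        (fun L => listWeight x L * listNumerator T P L), sum_congr rfl hinner, sum_add_distrib,
        ← sum_div, ← mul_sum, sum_stepWeight_telescope hx, sum_stepWeight_mul_total hx n.succ_pos,
        mul_assoc, prod_mul_total hx0, if_neg n.succ_ne_zero, Nat.add_sub_cancel]
      simp only [hTdef]
      ring

/-- The identity in an arbitrary field, for a nonzero element `t` whose powers are distinct. -/
lemma sum_composition_of_pow_injective {n q : ℕ} (hn : 0 < n) (hq : 2 ≤ q) {t : K} (ht : t ≠ 0)
    (hpow : Function.Injective fun m : ℕ => t ^ m) (s : K) :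
    (∑ I : Composition n, (-1 : K) ^ (n - I.length) *
      ((1 - t ^ (q ^ I.sizeUpTo 1 - 1)
        + ∑ i ∈ Finset.Icc 1 (I.length - 1),
            (t ^ (q ^ I.sizeUpTo i - 1) - t ^ (q ^ I.sizeUpTo (i + 1) - 1)) *
              ∏ j ∈ range (I.sizeUpTo i), (1 + s * (t ^ q ^ j)⁻¹)
        + t ^ (q ^ n - 1) * ∏ j ∈ range n, (1 + s * (t ^ q ^ j)⁻¹)) /
       ∏ i : Fin I.length, ∏ j ∈ Finset.Icc 1 (I.blocksFun i),
         (1 - t ^ (q ^ I.sizeUpTo ((i : ℕ) + 1)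
            - q ^ (I.sizeUpTo ((i : ℕ) + 1) - j)))))
    = (t ^ n)⁻¹ *
        ((s * t ^ (q ^ n - 1) + t ^ q ^ (n - 1)) *
          ∏ i ∈ range (n - 1), (s + t ^ q ^ i)) /
        ∏ i ∈ Finset.Icc 1 n, (1 - t ^ (q ^ i - 1)) := by
  obtain ⟨x, hxt⟩ : ∃ x : ℕ → K, ∀ m, t ^ q ^ m = x m := ⟨_, fun _ => rfl⟩
  have hx : Function.Injective x := fun a b h =>
    Nat.pow_right_injective hq (hpow (((hxt a).trans h).trans (hxt b).symm))
  have hx0 : ∀ i, x i ≠ 0 := fun i => hxt i ▸ pow_ne_zero _ ht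
  have hxz : x 0 = t := by simp [← hxt]
  have hT : ∀ m, t ^ (q ^ m - 1) = x m / x 0 := fun m => by
    rw [hxz, pow_sub₀ t ht (Nat.one_le_pow _ _ (by omega)), pow_one, hxt, div_eq_mul_inv]
  have hxdiv : ∀ a b, b ≤ a → t ^ (q ^ a - q ^ b) = x a / x b := fun a b h => by
    rw [pow_sub₀ t ht (Nat.pow_le_pow_right (by omega) h), hxt, hxt, div_eq_mul_inv]
  have hmain := sum_listWeight_mul_listNumerator hx hx0 s n
  refine Eq.trans (sum_congr rfl fun I _ => ?_) (hmain.trans ?_)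
  · have hden : ∏ i : Fin I.length, ∏ j ∈ Finset.Icc 1 (I.blocksFun i),
         (1 - t ^ (q ^ I.sizeUpTo ((i : ℕ) + 1)
            - q ^ (I.sizeUpTo ((i : ℕ) + 1) - j))) =
        ∏ i ∈ range I.blocks.length,
          blockWeight x (I.blocks.take (i + 1)).sum (I.blocks.getD i 0) := by
      rw [prod_range]
      refine prod_congr rfl fun i _ => ?_
      rw [List.getD_eq_getElem _ _ i.2]
      refine prod_congr rfl fun j _ => ?_
      rw [hxdiv _ _ (Nat.sub_le _ _)]
      rfl
    rw [hden, listWeight, listNumerator, I.blocks_sum]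
    simp only [hT, hxt]
    exact (mul_div_assoc _ _ _).symm.trans (div_mul_eq_mul_div _ _ _).symm
  · obtain ⟨n, rfl⟩ := Nat.exists_eq_add_of_lt hn
    rw [zero_add, if_neg n.succ_ne_zero, Nat.add_sub_cancel, twistedTotal_succ]
    have hP : ∀ m, ∏ i ∈ Finset.Icc 1 m, (1 - t ^ (q ^ i - 1)) =
        (t ^ m)⁻¹ * ∏ i ∈ range m, (x 0 - x (i + 1)) := by
      intro m
      induction m with
      | zero => simp
      | succ m ih =>
        have := hx0 0
        rw [prod_Icc_succ_top (by omega), ih, prod_range_succ, hT, ← hxz]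
        field_simp
        ring
    have hQ : ∀ m, ∏ i ∈ range m, (x 0 - x (i + 1)) ≠ 0 := fun m =>
      prod_ne_zero_iff.2 fun i _ => sub_ne_zero.2 (hx.ne i.succ_ne_zero.symm)
    have hlast : x 0 - x (n + 1) ≠ 0 := sub_ne_zero.2 (hx.ne n.succ_ne_zero.symm)
    have hnum : ∏ i ∈ range n, (s + t ^ q ^ i) = ∏ i ∈ range n, (x i + s) :=
      prod_congr rfl fun i _ => by rw [hxt, add_comm]
    rw [hP, hT, hxt, hnum, twistedTotal, prod_div_distrib, prod_range_succ, ← hxz]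
    have h1 := hQ n
    have h2 := hx0 0
    field_simp
    ring

end CompositionIdentity

/-- **The combinatorial identity (4.5)** (Wan–Wang). For every integer `q ≥ 2`
(not necessarily a prime power), in the field `ℚ(t,s)` of rational functions
(realized as the fraction field of `ℚ[t,s]`, with `t = X 0` and `s = X 1`):
`X(t,s;q) = t^{−n} (s t^{qⁿ−1} + t^{q^{n−1}}) ∏_{i=0}^{n−2}(s + t^{qⁱ}) / ∏_{i=1}^{n}(1 − t^{qⁱ−1})`,
where `X(t,s;q)` is the alternating sum over all compositions `I = (n_1,…,n_ℓ)`
of `n` of the rational functions from Theorem 3.3. -/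
theorem combinatorial_identity_rational_functions (n q : ℕ) (hn : 0 < n) (hq : 2 ≤ q) :
    let K := FractionRing (MvPolynomial (Fin 2) ℚ)
    let t : K := algebraMap (MvPolynomial (Fin 2) ℚ) K (X 0)
    let s : K := algebraMap (MvPolynomial (Fin 2) ℚ) K (X 1)
    (∑ I : Composition n, (-1 : K) ^ (n - I.length) *
      ((1 - t ^ (q ^ I.sizeUpTo 1 - 1)
        + ∑ i ∈ Finset.Icc 1 (I.length - 1),
            (t ^ (q ^ I.sizeUpTo i - 1) - t ^ (q ^ I.sizeUpTo (i + 1) - 1)) *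
              ∏ j ∈ range (I.sizeUpTo i), (1 + s * (t ^ q ^ j)⁻¹)
        + t ^ (q ^ n - 1) * ∏ j ∈ range n, (1 + s * (t ^ q ^ j)⁻¹)) /
       ∏ i : Fin I.length, ∏ j ∈ Finset.Icc 1 (I.blocksFun i),
         (1 - t ^ (q ^ I.sizeUpTo ((i : ℕ) + 1)
            - q ^ (I.sizeUpTo ((i : ℕ) + 1) - j)))))
    = (t ^ n)⁻¹ *
        ((s * t ^ (q ^ n - 1) + t ^ q ^ (n - 1)) *
          ∏ i ∈ range (n - 1), (s + t ^ q ^ i)) /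
        ∏ i ∈ Finset.Icc 1 n, (1 - t ^ (q ^ i - 1)) := by
  intro K t s
  have ht : t ≠ 0 := by simp [t]
  have hpow : Function.Injective fun m : ℕ => t ^ m := by
    intro a b h
    have h' : (X 0 : MvPolynomial (Fin 2) ℚ) ^ a = X 0 ^ b := by
      apply IsFractionRing.injective (MvPolynomial (Fin 2) ℚ) K
      simpa [t] using h
    have := congrArg totalDegree h'
    simpa using this
  exact CompositionIdentity.sum_composition_of_pow_injective hn hq ht hpow s

end
end
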